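/- arXiv:1406.5516 — 2 statements merged into one kernel-verified Lean document; each statement's English description precedes it below -/
import Mathlib

section
/- Let Ω ⊂ ℍ be a simply connected open set with Ω ∩ ℝ ≠ ∅ and x₀ ∈ Ω ∩ ℝ, and suppose there exists a bijective quaternionic intrinsic slice regular map f : Ω → 𝔹 onto the open unit ball with f(x₀) = 0 and f′(x₀) > 0. Then for every unit imaginary quaternion I the slice Ω ∩ ℂ_I is symmetric with respect to the real axis and simply connected, and Ω is axially symmetric; hence Ω ∈ 𝔯(ℍ). -/
noncomputable section

/-- The complex plane `ℂ_I = {x + I y : x, y ∈ ℝ}` inside the quaternions, for a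
unit imaginary quaternion `I`. -/
def slicePlane (I : Quaternion ℝ) : Set (Quaternion ℝ) :=
  {q | ∃ x y : ℝ, q = (x : Quaternion ℝ) + y • I}

/-- A set `U ⊆ ℍ` is axially symmetric if `x + I y ∈ U` implies `x + J y ∈ U`
for all unit imaginary quaternions `J`. -/
def AxiallySymmetric (U : Set (Quaternion ℝ)) : Prop :=
  ∀ (x y : ℝ) (I J : Quaternion ℝ), I ^ 2 = -1 → J ^ 2 = -1 →
    ((x : Quaternion ℝ) + y • I) ∈ U → ((x : Quaternion ℝ) + y • J) ∈ U

/-- `f` is slice regular on `U`: it is real differentiable on `U` and for every unit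
imaginary quaternion `I` its restriction to `U ∩ ℂ_I` satisfies
`(1/2)(∂/∂x + I ∂/∂y) f(x + I y) = 0`. -/
def SliceRegularOn (f : Quaternion ℝ → Quaternion ℝ) (U : Set (Quaternion ℝ)) : Prop :=
  DifferentiableOn ℝ f U ∧
  ∀ (I : Quaternion ℝ), I ^ 2 = -1 → ∀ x y : ℝ, ((x : Quaternion ℝ) + y • I) ∈ U →
    fderiv ℝ (fun p : ℝ × ℝ => f ((p.1 : Quaternion ℝ) + p.2 • I)) (x, y) (1, 0)
      + I * fderiv ℝ (fun p : ℝ × ℝ => f ((p.1 : Quaternion ℝ) + p.2 • I)) (x, y) (0, 1) = 0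

/-- The slice derivative of `f` at `q`, i.e. `(∂/∂x) f`. -/
def sliceDeriv (f : Quaternion ℝ → Quaternion ℝ) (q : Quaternion ℝ) : Quaternion ℝ :=
  fderiv ℝ f q 1

/-- A quaternion is a (strictly) positive real number. -/
def IsPosReal (q : Quaternion ℝ) : Prop := ∃ r : ℝ, 0 < r ∧ q = (r : Quaternion ℝ)

/-- `f ∈ 𝒩(U)`: `f` is slice regular on `U` and preserves every slice `ℂ_I`. -/
def QIntrinsicOn (f : Quaternion ℝ → Quaternion ℝ) (U : Set (Quaternion ℝ)) : Prop :=
  SliceRegularOn f U ∧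
  ∀ (I : Quaternion ℝ), I ^ 2 = -1 → ∀ q ∈ U ∩ slicePlane I, f q ∈ slicePlane I

/-- The class `𝔯(ℍ)` of axially symmetric open sets whose intersection with every
slice plane `ℂ_I` is simply connected. -/
def MemFrakR (Ω : Set (Quaternion ℝ)) : Prop :=
  IsOpen Ω ∧ AxiallySymmetric Ω ∧
  ∀ I : Quaternion ℝ, I ^ 2 = -1 → SimplyConnectedSpace ↥(Ω ∩ slicePlane I)

/-- `S` is a Jordan region in the plane `ℂ_I`: a bounded subset of `ℂ_I`, open in `ℂ_I`,
whose boundary (inside `ℂ_I`) is a Jordan curve. -/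
def IsJordanRegionIn (I : Quaternion ℝ) (S : Set (Quaternion ℝ)) : Prop :=
  S ⊆ slicePlane I ∧ Bornology.IsBounded S ∧
  IsOpen (Subtype.val ⁻¹' S : Set ↥(slicePlane I)) ∧
  ∃ γ : Circle → ↥(slicePlane I), Continuous γ ∧ Function.Injective γ ∧
    Set.range γ = frontier (Subtype.val ⁻¹' S : Set ↥(slicePlane I))

/-- The axially symmetric completion `⋃_{x+Jy ∈ Ω, I ∈ 𝕊} {x + I y}` of a subset `Ω`
of the slice plane `ℂ_J`. -/
def axSymmCompletion (J : Quaternion ℝ) (Ω : Set (Quaternion ℝ)) : Set (Quaternion ℝ) :=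
  {q | ∃ x y : ℝ, ∃ I : Quaternion ℝ, I ^ 2 = -1 ∧
    ((x : Quaternion ℝ) + y • J) ∈ Ω ∧ q = (x : Quaternion ℝ) + y • I}

/-- The first modulus of continuity `ω₁(f; δ)` of `f` on the set `K`. -/
def omega1 (f : Quaternion ℝ → Quaternion ℝ) (K : Set (Quaternion ℝ)) (δ : ℝ) : ℝ :=
  sSup {r : ℝ | ∃ u ∈ K, ∃ v ∈ K, ‖u - v‖ ≤ δ ∧ r = ‖f u - f v‖}

open Set Filter Topology
open scoped Quaternion

/-- An injective holomorphic function on an open set of the plane is an open map. -/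
theorem isOpen_image_of_injOn {F : ℂ → ℂ} {U V : Set ℂ} (hU : IsOpen U)
    (hF : DifferentiableOn ℂ F U) (hinj : InjOn F U) (hV : IsOpen V) (hVU : V ⊆ U) :
    IsOpen (F '' V) := by
  rw [isOpen_iff_mem_nhds]
  rintro _ ⟨z, hz, rfl⟩
  have hzU := hU.mem_nhds (hVU hz)
  refine (hF.analyticAt hzU).eventually_constant_or_nhds_le_map_nhds.resolve_left (fun h ↦ ?_)
    (image_mem_map (hV.mem_nhds hz))
  have h' : ∀ᶠ w in 𝓝[≠] z, False := by
    filter_upwards [h.filter_mono nhdsWithin_le_nhds, mem_nhdsWithin_of_mem_nhds hzU,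
      self_mem_nhdsWithin] with w hw hwU hne
    exact hne (hinj hwU (hVU hz) hw)
  exact h'.exists.elim fun _ ↦ id

/-- A left inverse of an injective holomorphic function on an open set is continuous. -/
theorem continuousAt_leftInverse_of_injOn {F h : ℂ → ℂ} {U : Set ℂ} (hU : IsOpen U)
    (hF : DifferentiableOn ℂ F U) (hinj : InjOn F U) (hh : LeftInvOn h F U) {z : ℂ} (hz : z ∈ U) :
    ContinuousAt h (F z) := by
  intro N hN
  rw [hh hz] at hN
  obtain ⟨V, hVN, hV, hzV⟩ := mem_nhds_iff.mp (inter_mem hN (hU.mem_nhds hz))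
  have hVU : V ⊆ U := fun w hw ↦ (hVN hw).2
  refine mem_map.mpr (mem_of_superset
    ((isOpen_image_of_injOn hU hF hinj hV hVU).mem_nhds (mem_image_of_mem F hzV)) ?_)
  rintro _ ⟨w, hw, rfl⟩
  simpa [hh (hVU hw)] using (hVN hw).1

theorem eventually_eq_leftInverse_of_injOn {F h : ℂ → ℂ} {U : Set ℂ} (hU : IsOpen U)
    (hF : DifferentiableOn ℂ F U) (hinj : InjOn F U) (hh : LeftInvOn h F U) {z : ℂ} (hz : z ∈ U) :
    ∀ᶠ w in 𝓝 (F z), F (h w) = w := by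
  filter_upwards [(isOpen_image_of_injOn hU hF hinj hU subset_rfl).mem_nhds
    (mem_image_of_mem F hz)]
  rintro _ ⟨w, hw, rfl⟩
  rw [hh hw]

theorem differentiableAt_leftInverse_of_deriv_ne_zero {F h : ℂ → ℂ} {U : Set ℂ} (hU : IsOpen U)
    (hF : DifferentiableOn ℂ F U) (hinj : InjOn F U) (hh : LeftInvOn h F U) {z : ℂ} (hz : z ∈ U)
    (hd : deriv F z ≠ 0) : DifferentiableAt ℂ h (F z) := by
  have hFz : HasDerivAt F (deriv F z) (h (F z)) := by
    rw [hh hz]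
    exact (hF.differentiableAt (hU.mem_nhds hz)).hasDerivAt
  exact (HasDerivAt.of_local_left_inverse (continuousAt_leftInverse_of_injOn hU hF hinj hh hz)
    hFz hd (eventually_eq_leftInverse_of_injOn hU hF hinj hh hz)).differentiableAt

/-- An injective holomorphic function on an open set has a nowhere vanishing derivative. -/
theorem deriv_ne_zero_of_injOn {F : ℂ → ℂ} {U : Set ℂ} (hU : IsOpen U)
    (hF : DifferentiableOn ℂ F U) (hinj : InjOn F U) {z : ℂ} (hz : z ∈ U) : deriv F z ≠ 0 := by
  have hh : LeftInvOn (Function.invFunOn F U) F U := hinj.leftInvOn_invFunOn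
  set h := Function.invFunOn F U
  have hcont := continuousAt_leftInverse_of_injOn hU hF hinj hh hz
  have hright := eventually_eq_leftInverse_of_injOn hU hF hinj hh hz
  have hzU := hU.mem_nhds hz
  have hd : ∀ᶠ w in 𝓝[≠] z, deriv F w ≠ 0 := by
    refine (hF.analyticAt hzU).deriv.eventually_eq_zero_or_eventually_ne_zero.resolve_left
      fun h0 ↦ ?_
    obtain ⟨ε, hε, hball⟩ := Metric.eventually_nhds_iff_ball.mp
      (h0.and (hU.eventually_mem hz))
    have hconst : ∀ w ∈ Metric.ball z ε, F w = F z := fun w hw ↦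
      Metric.isOpen_ball.is_const_of_deriv_eq_zero (convex_ball z ε).isPreconnected
        (hF.mono fun w hw ↦ (hball w hw).2) (fun w hw ↦ (hball w hw).1) hw
        (Metric.mem_ball_self hε)
    have h' : ∀ᶠ w in 𝓝[≠] z, False := by
      filter_upwards [mem_nhdsWithin_of_mem_nhds (Metric.ball_mem_nhds z hε),
        self_mem_nhdsWithin] with w hw hne
      exact hne (hinj (hball w hw).2 hz (hconst w hw))
    exact h'.exists.elim fun _ ↦ id
  have hhd : DifferentiableAt ℂ h (F z) := by
    refine (Complex.analyticAt_of_differentiable_on_punctured_nhds_of_continuousAt ?_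
      hcont).differentiableAt
    have htend : Tendsto h (𝓝[≠] (F z)) (𝓝[≠] z) := by
      refine tendsto_nhdsWithin_iff.mpr ⟨?_, ?_⟩
      · have := hcont.tendsto
        rw [hh hz] at this
        exact this.mono_left nhdsWithin_le_nhds
      · filter_upwards [hright.filter_mono nhdsWithin_le_nhds, self_mem_nhdsWithin] with w hw hne heq
        have heq : h w = z := heq
        exact hne (by rw [mem_singleton_iff, ← hw, heq])
    filter_upwards [htend.eventually hd, htend.eventually (mem_nhdsWithin_of_mem_nhds hzU),
      hright.filter_mono nhdsWithin_le_nhds] with w hw hwU hwF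
    have := differentiableAt_leftInverse_of_deriv_ne_zero hU hF hinj hh hwU hw
    rwa [hwF] at this
  intro h0
  have hcomp : HasDerivAt (h ∘ F) (deriv h (F z) * deriv F z) z :=
    hhd.hasDerivAt.comp z (hF.differentiableAt hzU).hasDerivAt
  have hid : HasDerivAt (h ∘ F) 1 z :=
    (hasDerivAt_id z).congr_of_eventuallyEq
      ((hU.eventually_mem hz).mono fun w hw ↦ hh hw)
  have := hcomp.unique hid
  simp [h0] at this

theorem differentiableOn_leftInverse_of_bijOn {F h : ℂ → ℂ} {U W : Set ℂ} (hU : IsOpen U)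
    (hF : DifferentiableOn ℂ F U) (hbij : BijOn F U W) (hh : LeftInvOn h F U) :
    DifferentiableOn ℂ h W := by
  intro w hw
  obtain ⟨z, hz, rfl⟩ := hbij.surjOn hw
  exact (differentiableAt_leftInverse_of_deriv_ne_zero hU hF hbij.injOn hh hz
    (deriv_ne_zero_of_injOn hU hF hbij.injOn hz)).differentiableWithinAt

/-- Two holomorphic functions on the unit disc that agree on the real diameter are equal. -/
theorem eqOn_ball_of_eqOn_real {g h : ℂ → ℂ} (hg : DifferentiableOn ℂ g (Metric.ball 0 1))
    (hh : DifferentiableOn ℂ h (Metric.ball 0 1))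
    (hgh : ∀ r : ℝ, |r| < 1 → g r = h r) : EqOn g h (Metric.ball 0 1) := by
  refine (hg.analyticOnNhd Metric.isOpen_ball).eqOn_of_preconnected_of_frequently_eq
    (hh.analyticOnNhd Metric.isOpen_ball) (convex_ball 0 1).isPreconnected
    (Metric.mem_ball_self one_pos) ?_
  have ht : Tendsto (fun r : ℝ ↦ (r : ℂ)) (𝓝[≠] 0) (𝓝[≠] 0) := by
    refine tendsto_nhdsWithin_iff.mpr ⟨?_, ?_⟩
    · exact (Complex.continuous_ofReal.tendsto' 0 0 (by simp)).mono_left nhdsWithin_le_nhds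
    · filter_upwards [self_mem_nhdsWithin] with r hr
      simpa using hr
  refine ht.frequently (Eventually.frequently ?_)
  filter_upwards [mem_nhdsWithin_of_mem_nhds (Metric.ball_mem_nhds (0 : ℝ) one_pos)] with r hr
  exact hgh r (by simpa using hr)

/-- The embedding `x + i y ↦ x + I y` of `ℂ` onto the slice plane `ℂ_I`. -/
def sliceEmb (I : Quaternion ℝ) : ℂ →L[ℝ] Quaternion ℝ :=
  Complex.reCLM.smulRight 1 + Complex.imCLM.smulRight I

/-- The coordinate `q ↦ re q - i re (q I)`, a left inverse of `sliceEmb I` when `I² = -1`. -/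
def sliceProj (I : Quaternion ℝ) : Quaternion ℝ →L[ℝ] ℂ :=
  LinearMap.toContinuousLinearMap
    { toFun := fun q ↦ ⟨q.re, -(q * I).re⟩
      map_add' := fun p q ↦ by
        apply Complex.ext
        · simp
        · simp only [add_mul, Quaternion.re_add, Complex.add_im]; ring
      map_smul' := fun c q ↦ by
        apply Complex.ext
        · simp
        · simp; ring }

theorem sliceEmb_apply (I : Quaternion ℝ) (z : ℂ) :
    sliceEmb I z = (z.re : Quaternion ℝ) + z.im • I := by
  have : (z.re : Quaternion ℝ) = z.re • (1 : Quaternion ℝ) := by ext <;> simp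
  simp [sliceEmb, this]

theorem sliceEmb_mk (I : Quaternion ℝ) (x y : ℝ) :
    sliceEmb I ⟨x, y⟩ = (x : Quaternion ℝ) + y • I := sliceEmb_apply I ⟨x, y⟩

theorem sliceEmb_ofReal (I : Quaternion ℝ) (x : ℝ) : sliceEmb I x = x := by
  simp [sliceEmb_apply]

theorem sliceProj_apply (I q : Quaternion ℝ) : sliceProj I q = ⟨q.re, -(q * I).re⟩ := rfl

theorem sliceEmb_mem_slicePlane (I : Quaternion ℝ) (z : ℂ) : sliceEmb I z ∈ slicePlane I :=
  ⟨z.re, z.im, sliceEmb_apply I z⟩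

theorem re_eq_zero_of_sq_eq_neg_one {I : Quaternion ℝ} (hI : I ^ 2 = -1) : I.re = 0 := by
  have h0 := congrArg QuaternionAlgebra.re hI
  have h1 := congrArg QuaternionAlgebra.imI hI
  have h2 := congrArg QuaternionAlgebra.imJ hI
  have h3 := congrArg QuaternionAlgebra.imK hI
  simp [sq] at h0 h1 h2 h3
  by_contra h
  have e1 : I.imI = 0 := by
    apply mul_left_cancel₀ h; linarith
  have e2 : I.imJ = 0 := by
    apply mul_left_cancel₀ h; linarith
  have e3 : I.imK = 0 := by
    apply mul_left_cancel₀ h; linarith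
  rw [e1, e2, e3] at h0
  nlinarith [sq_nonneg I.re]

theorem sum_sq_eq_one_of_sq_eq_neg_one {I : Quaternion ℝ} (hI : I ^ 2 = -1) :
    I.imI ^ 2 + I.imJ ^ 2 + I.imK ^ 2 = 1 := by
  have h0 := congrArg QuaternionAlgebra.re hI
  simp [sq, re_eq_zero_of_sq_eq_neg_one hI] at h0
  linarith

theorem sliceProj_sliceEmb {I : Quaternion ℝ} (hI : I ^ 2 = -1) (z : ℂ) :
    sliceProj I (sliceEmb I z) = z := by
  rw [sliceProj_apply, sliceEmb_apply]
  have hre := re_eq_zero_of_sq_eq_neg_one hI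
  have hII : (I * I).re = -1 := by rw [← sq, hI]; simp
  apply Complex.ext
  · simp [hre]
  · simp only [add_mul, smul_mul_assoc, Quaternion.re_add, Quaternion.re_smul, hII]
    simp [hre]

theorem sliceEmb_injective {I : Quaternion ℝ} (hI : I ^ 2 = -1) :
    Function.Injective (sliceEmb I) :=
  Function.LeftInverse.injective (sliceProj_sliceEmb hI)

theorem sliceEmb_sliceProj {I q : Quaternion ℝ} (hI : I ^ 2 = -1) (hq : q ∈ slicePlane I) :
    sliceEmb I (sliceProj I q) = q := by
  obtain ⟨x, y, rfl⟩ := hq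
  rw [← sliceEmb_mk, sliceProj_sliceEmb hI]

theorem sliceProj_left_mul {I : Quaternion ℝ} (hI : I ^ 2 = -1) (q : Quaternion ℝ) :
    sliceProj I (I * q) = Complex.I * sliceProj I q := by
  have hre := re_eq_zero_of_sq_eq_neg_one hI
  have hs := sum_sq_eq_one_of_sq_eq_neg_one hI
  apply Complex.ext
  · simp [sliceProj_apply, hre]; ring
  · simp [sliceProj_apply, hre]; linear_combination q.re * hs

theorem norm_sliceEmb {I : Quaternion ℝ} (hI : I ^ 2 = -1) (z : ℂ) : ‖sliceEmb I z‖ = ‖z‖ := by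
  have hre := re_eq_zero_of_sq_eq_neg_one hI
  have hs := sum_sq_eq_one_of_sq_eq_neg_one hI
  rw [← sq_eq_sq₀ (norm_nonneg _) (norm_nonneg _), sq, ← Quaternion.normSq_eq_norm_mul_self,
    ← Complex.normSq_eq_norm_sq, sliceEmb_apply, Quaternion.normSq_def', Complex.normSq_apply]
  simp [hre]
  linear_combination z.im ^ 2 * hs

theorem exists_sq_eq_neg_one {a b c : ℝ} (h : a ^ 2 + b ^ 2 + c ^ 2 = 1) :
    ∃ I : Quaternion ℝ, I ^ 2 = -1 ∧ I.re = 0 ∧ I.imI = a ∧ I.imJ = b ∧ I.imK = c := by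
  obtain ⟨I, hre, hi, hj, hk⟩ :
      ∃ I : Quaternion ℝ, I.re = 0 ∧ I.imI = a ∧ I.imJ = b ∧ I.imK = c :=
    ⟨⟨0, a, b, c⟩, rfl, rfl, rfl, rfl⟩
  refine ⟨I, ?_, hre, hi, hj, hk⟩
  rw [sq]
  ext
  · simp [hre, hi, hj, hk]; linarith
  all_goals simp [hre, hi, hj, hk]; ring

/-- Every quaternion lies in some slice plane. -/
theorem exists_sliceEmb_eq (q : Quaternion ℝ) :
    ∃ I : Quaternion ℝ, I ^ 2 = -1 ∧ ∃ z : ℂ, sliceEmb I z = q := by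
  by_cases h : q.imI ^ 2 + q.imJ ^ 2 + q.imK ^ 2 = 0
  · obtain ⟨I, hI, -⟩ := exists_sq_eq_neg_one (a := 1) (b := 0) (c := 0) (by norm_num)
    have h1 : q.imI = 0 := by nlinarith [sq_nonneg q.imI, sq_nonneg q.imJ, sq_nonneg q.imK]
    have h2 : q.imJ = 0 := by nlinarith [sq_nonneg q.imI, sq_nonneg q.imJ, sq_nonneg q.imK]
    have h3 : q.imK = 0 := by nlinarith [sq_nonneg q.imI, sq_nonneg q.imJ, sq_nonneg q.imK]
    refine ⟨I, hI, q.re, ?_⟩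
    rw [sliceEmb_ofReal]
    ext <;> simp [h1, h2, h3]
  · set s := √(q.imI ^ 2 + q.imJ ^ 2 + q.imK ^ 2)
    have hss : s ^ 2 = q.imI ^ 2 + q.imJ ^ 2 + q.imK ^ 2 := Real.sq_sqrt (by positivity)
    have hs0 : s ≠ 0 := fun h0 ↦ h (by rw [← hss, h0]; simp)
    obtain ⟨I, hI, hre, hi, hj, hk⟩ := exists_sq_eq_neg_one
      (a := q.imI / s) (b := q.imJ / s) (c := q.imK / s) (by field_simp; linarith)
    refine ⟨I, hI, ⟨q.re, s⟩, ?_⟩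
    rw [sliceEmb_mk]
    ext <;> simp [hre, hi, hj, hk, mul_div_cancel₀ _ hs0]

/-- Two slice planes that share a non-real point coincide. -/
theorem sliceEmb_mem_slicePlane_of_eq {I J : Quaternion ℝ} (hI : I ^ 2 = -1) (hJ : J ^ 2 = -1)
    {z w : ℂ} (h : sliceEmb J z = sliceEmb I w) (hw : w.im ≠ 0) (u : ℂ) :
    sliceEmb J u ∈ slicePlane I := by
  have hre : z.re = w.re := by
    simpa [sliceEmb_apply, re_eq_zero_of_sq_eq_neg_one hI, re_eq_zero_of_sq_eq_neg_one hJ]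
      using congrArg QuaternionAlgebra.re h
  rw [sliceEmb_apply, sliceEmb_apply, hre, add_right_inj] at h
  have hz : z.im ≠ 0 := by
    intro h0
    rw [h0, zero_smul, eq_comm, smul_eq_zero] at h
    rcases h with h | rfl
    · exact hw h
    · simp at hI
  refine ⟨u.re, u.im * (z.im⁻¹ * w.im), ?_⟩
  rw [sliceEmb_apply, mul_smul, mul_smul, ← h, inv_smul_smul₀ hz]

theorem eq_coe_re_of_mem_slicePlanes {q : Quaternion ℝ}
    (h : ∀ I : Quaternion ℝ, I ^ 2 = -1 → q ∈ slicePlane I) : q = (q.re : Quaternion ℝ) := by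
  obtain ⟨I, hI, -, -, hIj, hIk⟩ :=
    exists_sq_eq_neg_one (a := 1) (b := 0) (c := 0) (by norm_num)
  obtain ⟨J, hJ, -, hJi, -, -⟩ := exists_sq_eq_neg_one (a := 0) (b := 1) (c := 0) (by norm_num)
  obtain ⟨x, y, h1⟩ := h I hI
  obtain ⟨x', y', h2⟩ := h J hJ
  have e1 : q.imI = 0 := by simp [h2, hJi]
  have e2 : q.imJ = 0 := by simp [h1, hIj]
  have e3 : q.imK = 0 := by simp [h1, hIk]
  ext <;> simp [e1, e2, e3]

/-- The map `f` restricted to the slice plane `ℂ_I`, in the complex coordinate of that plane. -/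
def sliceRestr (f : Quaternion ℝ → Quaternion ℝ) (I : Quaternion ℝ) (z : ℂ) : ℂ :=
  sliceProj I (f (sliceEmb I z))

section

variable {f : Quaternion ℝ → Quaternion ℝ} {Ω : Set (Quaternion ℝ)} {I : Quaternion ℝ}

theorem isOpen_preimage_sliceEmb (hΩ : IsOpen Ω) (I : Quaternion ℝ) :
    IsOpen (sliceEmb I ⁻¹' Ω) :=
  hΩ.preimage (sliceEmb I).continuous

theorem differentiableOn_sliceRestr (hΩ : IsOpen Ω) (hf : SliceRegularOn f Ω)
    (hI : I ^ 2 = -1) : DifferentiableOn ℂ (sliceRestr f I) (sliceEmb I ⁻¹' Ω) := by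
  intro z hz
  refine DifferentiableAt.differentiableWithinAt ?_
  have hfz : HasFDerivAt f (fderiv ℝ f (sliceEmb I z)) (sliceEmb I z) :=
    (hf.1.differentiableAt (hΩ.mem_nhds hz)).hasFDerivAt
  have hF : HasFDerivAt (sliceRestr f I)
      ((sliceProj I).comp ((fderiv ℝ f (sliceEmb I z)).comp (sliceEmb I))) z :=
    (sliceProj I).hasFDerivAt.comp z (hfz.comp z (sliceEmb I).hasFDerivAt)
  refine differentiableAt_complex_iff_differentiableAt_real.mpr ⟨hF.differentiableAt, ?_⟩
  rw [hF.fderiv]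
  let e : ℝ × ℝ →L[ℝ] Quaternion ℝ :=
    (sliceEmb I).comp (Complex.equivRealProdCLM.symm : ℝ × ℝ →L[ℝ] ℂ)
  have he (p : ℝ × ℝ) : e p = (p.1 : Quaternion ℝ) + p.2 • I := by
    rw [← sliceEmb_mk]
    rfl
  have hez : e (z.re, z.im) = sliceEmb I z := by rw [he, sliceEmb_apply]
  have hcr := hf.2 I hI z.re z.im (by rw [← sliceEmb_apply]; exact hz)
  simp_rw [← he] at hcr
  have hfe : HasFDerivAt (fun p ↦ f (e p)) ((fderiv ℝ f (sliceEmb I z)).comp e) (z.re, z.im) := by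
    rw [← hez] at hfz ⊢
    exact hfz.comp _ e.hasFDerivAt
  rw [hfe.fderiv] at hcr
  have h1 : e (1, 0) = sliceEmb I 1 := by rw [he, sliceEmb_apply]; simp
  have h2 : e (0, 1) = sliceEmb I Complex.I := by rw [he, sliceEmb_apply]; simp
  simp only [ContinuousLinearMap.comp_apply, h1, h2] at hcr ⊢
  rw [eq_neg_of_add_eq_zero_left hcr, map_neg, sliceProj_left_mul hI, smul_eq_mul, mul_neg,
    ← mul_assoc, Complex.I_mul_I]
  ring

theorem sliceEmb_sliceRestr (hf : QIntrinsicOn f Ω) (hI : I ^ 2 = -1) {z : ℂ}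
    (hz : sliceEmb I z ∈ Ω) : sliceEmb I (sliceRestr f I z) = f (sliceEmb I z) :=
  sliceEmb_sliceProj hI (hf.2 I hI _ ⟨hz, sliceEmb_mem_slicePlane I z⟩)

theorem injOn_sliceRestr (hf : QIntrinsicOn f Ω) (hinj : InjOn f Ω) (hI : I ^ 2 = -1) :
    InjOn (sliceRestr f I) (sliceEmb I ⁻¹' Ω) := by
  intro z hz w hw h
  refine sliceEmb_injective hI (hinj hz hw ?_)
  rw [← sliceEmb_sliceRestr hf hI hz, h, sliceEmb_sliceRestr hf hI hw]

theorem sliceRestr_ofReal (hf : QIntrinsicOn f Ω) (hI : I ^ 2 = -1) {x : ℝ}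
    (hx : (x : Quaternion ℝ) ∈ Ω) : sliceRestr f I x = (f x).re := by
  have hfx : f x = ((f x).re : Quaternion ℝ) := eq_coe_re_of_mem_slicePlanes fun J hJ ↦
    hf.2 J hJ _ ⟨hx, x, 0, by simp⟩
  calc sliceRestr f I x = sliceProj I (sliceEmb I ((f x).re : ℂ)) := by
        rw [sliceRestr, sliceEmb_ofReal, sliceEmb_ofReal, ← hfx]
    _ = (f x).re := sliceProj_sliceEmb hI _

/-- The image of the real points under an injective intrinsic slice regular map is open in `ℝ`. -/
theorem isOpen_image_real (hΩ : IsOpen Ω) (hf : QIntrinsicOn f Ω) (hinj : InjOn f Ω) :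
    IsOpen {r : ℝ | ∃ x : ℝ, (x : Quaternion ℝ) ∈ Ω ∧ f x = r} := by
  obtain ⟨I, hI, -⟩ := exists_sq_eq_neg_one (a := 1) (b := 0) (c := 0) (by norm_num)
  have hU := isOpen_preimage_sliceEmb hΩ I
  have hF := differentiableOn_sliceRestr hΩ hf.1 hI
  rw [isOpen_iff_mem_nhds]
  rintro r ⟨x, hx, hfx⟩
  have hxU : (x : ℂ) ∈ sliceEmb I ⁻¹' Ω := by rwa [mem_preimage, sliceEmb_ofReal]
  have hd := deriv_ne_zero_of_injOn hU hF (injOn_sliceRestr hf hinj hI) hxU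
  have hana := hF.analyticAt (hU.mem_nhds hxU)
  have hΩx : ∀ᶠ t : ℝ in 𝓝 x, (t : Quaternion ℝ) ∈ Ω :=
    Quaternion.continuous_coe.continuousAt.eventually_mem (hΩ.mem_nhds hx)
  have him : (deriv (sliceRestr f I) x).im = 0 := by
    have h1 : HasDerivAt (fun t : ℝ ↦ (sliceRestr f I t).im) (deriv (sliceRestr f I) x).im x :=
      Complex.imCLM.hasFDerivAt.comp_hasDerivAt x
        hana.differentiableAt.hasDerivAt.comp_ofReal
    refine h1.unique ((hasDerivAt_const x 0).congr_of_eventuallyEq ?_)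
    filter_upwards [hΩx] with t ht
    rw [sliceRestr_ofReal hf hI ht, Complex.ofReal_im]
  have hre : (deriv (sliceRestr f I) x).re ≠ 0 := fun h ↦ hd (Complex.ext h him)
  have hmap := hana.hasStrictDerivAt.real_of_complex.map_nhds_eq hre
  rw [sliceRestr_ofReal hf hI hx, Complex.ofReal_re, hfx, Quaternion.re_coe] at hmap
  rw [← hmap, mem_map]
  filter_upwards [hΩx] with t ht
  refine ⟨t, ht, ?_⟩
  rw [← sliceEmb_ofReal I t, ← sliceEmb_sliceRestr hf hI (by rwa [sliceEmb_ofReal]),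
    sliceRestr_ofReal hf hI ht, sliceEmb_ofReal]
  simp [sliceRestr_ofReal hf hI ht]

/-- Every real point of the ball has a real preimage. -/
theorem exists_real_preimage (hΩ : IsOpen Ω) (hf : QIntrinsicOn f Ω)
    (hbij : BijOn f Ω (Metric.ball 0 1)) {x₀ : ℝ} (hx₀ : (x₀ : Quaternion ℝ) ∈ Ω)
    (hf0 : f x₀ = 0) {r : ℝ} (hr : |r| < 1) : ∃ x : ℝ, (x : Quaternion ℝ) ∈ Ω ∧ f x = r := by
  let T : Set ℝ := ⋃ I ∈ {I : Quaternion ℝ | I ^ 2 = -1},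
    (fun r : ℝ ↦ (r : ℂ)) ⁻¹' (sliceRestr f I '' (sliceEmb I ⁻¹' Ω ∩ {z | z.im ≠ 0}))
  have hT : IsOpen T := isOpen_biUnion fun I hI ↦
    (isOpen_image_of_injOn (isOpen_preimage_sliceEmb hΩ I)
      (differentiableOn_sliceRestr hΩ hf.1 hI) (injOn_sliceRestr hf hbij.injOn hI)
      ((isOpen_preimage_sliceEmb hΩ I).inter (isOpen_ne_fun Complex.continuous_im
        continuous_const)) inter_subset_left).preimage Complex.continuous_ofReal
  refine isPreconnected_Ioo.subset_left_of_subset_union (isOpen_image_real hΩ hf hbij.injOn) hT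
    ?_ (s := Ioo (-1 : ℝ) 1) ?_ ⟨0, by simp, x₀, hx₀, by simpa using hf0⟩ (abs_lt.mp hr)
  · rw [Set.disjoint_left]
    rintro t ⟨x, hx, hfx⟩ ht
    simp only [T, mem_iUnion] at ht
    obtain ⟨I, hI, z, ⟨hz, him⟩, hzt⟩ := ht
    have h : sliceEmb I z = sliceEmb I x := by
      rw [sliceEmb_ofReal]
      refine hbij.injOn hz hx ?_
      rw [hfx, ← sliceEmb_sliceRestr hf hI hz, hzt, sliceEmb_ofReal]
    exact him (by rw [sliceEmb_injective hI h, Complex.ofReal_im])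
  · intro t ht
    have htb : (t : Quaternion ℝ) ∈ Metric.ball (0 : Quaternion ℝ) 1 := by
      simpa [Quaternion.norm_coe, abs_lt] using ht
    obtain ⟨p, hp, hpt⟩ := hbij.surjOn htb
    obtain ⟨I, hI, z, rfl⟩ := exists_sliceEmb_eq p
    by_cases him : z.im = 0
    · have hz : z = (z.re : ℂ) := Complex.ext rfl him
      rw [hz, sliceEmb_ofReal] at hp hpt
      exact Or.inl ⟨z.re, hp, hpt⟩
    · refine Or.inr (mem_biUnion hI ⟨z, ⟨hp, him⟩, ?_⟩)
      rw [sliceRestr, hpt, ← sliceEmb_ofReal I, sliceProj_sliceEmb hI]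

theorem bijOn_sliceRestr (hΩ : IsOpen Ω) (hf : QIntrinsicOn f Ω)
    (hbij : BijOn f Ω (Metric.ball 0 1)) {x₀ : ℝ} (hx₀ : (x₀ : Quaternion ℝ) ∈ Ω)
    (hf0 : f x₀ = 0) (hI : I ^ 2 = -1) :
    BijOn (sliceRestr f I) (sliceEmb I ⁻¹' Ω) (Metric.ball 0 1) := by
  refine ⟨fun z hz ↦ ?_, injOn_sliceRestr hf hbij.injOn hI, fun w hw ↦ ?_⟩
  · rw [mem_ball_zero_iff, ← norm_sliceEmb hI, sliceEmb_sliceRestr hf hI hz, ← mem_ball_zero_iff]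
    exact hbij.mapsTo hz
  rw [mem_ball_zero_iff] at hw
  by_cases him : w.im = 0
  · have hwr : w = (w.re : ℂ) := Complex.ext rfl him
    obtain ⟨x, hx, hfx⟩ := exists_real_preimage hΩ hf hbij hx₀ hf0
      ((Complex.abs_re_le_norm w).trans_lt hw)
    refine ⟨x, by rwa [mem_preimage, sliceEmb_ofReal], ?_⟩
    rw [sliceRestr_ofReal hf hI hx, hfx, Quaternion.re_coe, ← hwr]
  · obtain ⟨p, hp, hpw⟩ := hbij.surjOn (a := sliceEmb I w) (by simpa [norm_sliceEmb hI] using hw)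
    obtain ⟨J, hJ, z, rfl⟩ := exists_sliceEmb_eq p
    rw [← sliceEmb_sliceRestr hf hJ hp] at hpw
    have hz := sliceEmb_sliceProj hI (sliceEmb_mem_slicePlane_of_eq hI hJ hpw him z)
    refine ⟨sliceProj I (sliceEmb J z), by rwa [mem_preimage, hz], ?_⟩
    rw [sliceRestr, hz, ← sliceEmb_sliceRestr hf hJ hp, hpw, sliceProj_sliceEmb hI]

theorem preimage_sliceEmb_subset (hΩ : IsOpen Ω) (hf : QIntrinsicOn f Ω)
    (hbij : BijOn f Ω (Metric.ball 0 1)) {x₀ : ℝ} (hx₀ : (x₀ : Quaternion ℝ) ∈ Ω)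
    (hf0 : f x₀ = 0) (hI : I ^ 2 = -1) {J : Quaternion ℝ} (hJ : J ^ 2 = -1) :
    sliceEmb I ⁻¹' Ω ⊆ sliceEmb J ⁻¹' Ω := by
  have hbI := bijOn_sliceRestr hΩ hf hbij hx₀ hf0 hI
  have hbJ := bijOn_sliceRestr hΩ hf hbij hx₀ hf0 hJ
  have hEq := eqOn_ball_of_eqOn_real
    (differentiableOn_leftInverse_of_bijOn (isOpen_preimage_sliceEmb hΩ I)
      (differentiableOn_sliceRestr hΩ hf.1 hI) hbI hbI.injOn.leftInvOn_invFunOn)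
    (differentiableOn_leftInverse_of_bijOn (isOpen_preimage_sliceEmb hΩ J)
      (differentiableOn_sliceRestr hΩ hf.1 hJ) hbJ hbJ.injOn.leftInvOn_invFunOn)
    fun r hr ↦ by
      obtain ⟨x, hx, hfx⟩ := exists_real_preimage hΩ hf hbij hx₀ hf0 hr
      have key {K : Quaternion ℝ} (hK : K ^ 2 = -1) :
          Function.invFunOn (sliceRestr f K) (sliceEmb K ⁻¹' Ω) (r : ℂ) = x := by
        have := (injOn_sliceRestr hf hbij.injOn hK).leftInvOn_invFunOn
          (show (x : ℂ) ∈ sliceEmb K ⁻¹' Ω by rwa [mem_preimage, sliceEmb_ofReal])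
        rwa [sliceRestr_ofReal hf hK hx, hfx, Quaternion.re_coe] at this
      rw [key hI, key hJ]
  intro z hz
  rw [← hbI.injOn.leftInvOn_invFunOn hz, hEq (hbI.mapsTo hz)]
  exact hbJ.surjOn.mapsTo_invFunOn (hbI.mapsTo hz)

theorem axiallySymmetric_of_bijOn_ball (hΩ : IsOpen Ω) (hf : QIntrinsicOn f Ω)
    (hbij : BijOn f Ω (Metric.ball 0 1)) {x₀ : ℝ} (hx₀ : (x₀ : Quaternion ℝ) ∈ Ω)
    (hf0 : f x₀ = 0) : AxiallySymmetric Ω := by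
  intro x y I J hI hJ h
  rw [← sliceEmb_mk] at h ⊢
  exact preimage_sliceEmb_subset hΩ hf hbij hx₀ hf0 hI hJ h

theorem simplyConnectedSpace_slice (hΩ : IsOpen Ω) (hf : QIntrinsicOn f Ω)
    (hbij : BijOn f Ω (Metric.ball 0 1)) {x₀ : ℝ} (hx₀ : (x₀ : Quaternion ℝ) ∈ Ω)
    (hf0 : f x₀ = 0) (hI : I ^ 2 = -1) : SimplyConnectedSpace ↥(Ω ∩ slicePlane I) := by
  have hb := bijOn_sliceRestr hΩ hf hbij hx₀ hf0 hI
  have hF := differentiableOn_sliceRestr hΩ hf.1 hI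
  have hleft : LeftInvOn (Function.invFunOn (sliceRestr f I) (sliceEmb I ⁻¹' Ω)) (sliceRestr f I)
    (sliceEmb I ⁻¹' Ω) := hb.injOn.leftInvOn_invFunOn
  have hmem : MapsTo (Function.invFunOn (sliceRestr f I) (sliceEmb I ⁻¹' Ω)) (Metric.ball 0 1)
    (sliceEmb I ⁻¹' Ω) := hb.surjOn.mapsTo_invFunOn
  have hright : RightInvOn (Function.invFunOn (sliceRestr f I) (sliceEmb I ⁻¹' Ω))
    (sliceRestr f I) (Metric.ball 0 1) := hb.surjOn.rightInvOn_invFunOn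
  have hcont := (differentiableOn_leftInverse_of_bijOn (isOpen_preimage_sliceEmb hΩ I)
    hF hb hleft).continuousOn
  set h := Function.invFunOn (sliceRestr f I) (sliceEmb I ⁻¹' Ω)
  have hproj (q : ↥(Ω ∩ slicePlane I)) : sliceProj I q ∈ sliceEmb I ⁻¹' Ω := by
    rw [mem_preimage, sliceEmb_sliceProj hI q.2.2]
    exact q.2.1
  let e : ↥(Ω ∩ slicePlane I) ≃ₜ Metric.ball (0 : ℂ) 1 :=
    { toFun := fun q ↦ ⟨sliceRestr f I (sliceProj I q), hb.mapsTo (hproj q)⟩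
      invFun := fun w ↦ ⟨sliceEmb I (h w), hmem w.2, sliceEmb_mem_slicePlane I _⟩
      left_inv := fun q ↦ Subtype.ext (by
        change sliceEmb I (h (sliceRestr f I (sliceProj I q))) = q
        rw [hleft (hproj q), sliceEmb_sliceProj hI q.2.2])
      right_inv := fun w ↦ Subtype.ext (by
        change sliceRestr f I (sliceProj I (sliceEmb I (h w))) = w
        rw [sliceProj_sliceEmb hI, hright w.2])
      continuous_toFun := (hF.continuousOn.comp_continuous
        ((sliceProj I).continuous.comp continuous_subtype_val) hproj).subtype_mk _
      continuous_invFun := ((sliceEmb I).continuous.comp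
        (hcont.comp_continuous continuous_subtype_val Subtype.property)).subtype_mk _ }
  have : ContractibleSpace (Metric.ball (0 : ℂ) 1) := Metric.contractibleSpace_ball one_pos
  have := e.contractibleSpace
  infer_instance

end

/-- Let `Ω ⊂ ℍ` be a simply connected open set meeting `ℝ`, `x₀ ∈ Ω ∩ ℝ`, and suppose
there is a bijective quaternionic intrinsic slice regular `f : Ω → 𝔹` with `f(x₀) = 0`
and `f'(x₀) > 0`. Then for every unit imaginary quaternion `I` the slice `Ω ∩ ℂ_I` is
symmetric with respect to the real axis and simply connected, and `Ω` is axially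
symmetric; hence `Ω ∈ 𝔯(ℍ)`. -/
theorem riemann_map_forces_membership_in_frakR
    (Ω : Set (Quaternion ℝ)) (hΩopen : IsOpen Ω) (hΩsc : SimplyConnectedSpace ↥Ω)
    (hΩR : ∃ x : ℝ, (x : Quaternion ℝ) ∈ Ω)
    (x₀ : ℝ) (hx₀ : (x₀ : Quaternion ℝ) ∈ Ω)
    (f : Quaternion ℝ → Quaternion ℝ)
    (hf : QIntrinsicOn f Ω) (hfbij : Set.BijOn f Ω (Metric.ball 0 1))
    (hf0 : f (x₀ : Quaternion ℝ) = 0)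
    (hf' : IsPosReal (sliceDeriv f (x₀ : Quaternion ℝ))) :
    (∀ I : Quaternion ℝ, I ^ 2 = -1 →
      (∀ x y : ℝ, ((x : Quaternion ℝ) + y • I) ∈ Ω → ((x : Quaternion ℝ) - y • I) ∈ Ω) ∧
      SimplyConnectedSpace ↥(Ω ∩ slicePlane I)) ∧
    AxiallySymmetric Ω ∧ MemFrakR Ω := by
  have hax := axiallySymmetric_of_bijOn_ball hΩopen hf hfbij hx₀ hf0
  have hsc := fun (I : Quaternion ℝ) (hI : I ^ 2 = -1) ↦
    simplyConnectedSpace_slice hΩopen hf hfbij hx₀ hf0 hI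
  refine ⟨fun I hI ↦ ⟨fun x y h ↦ ?_, hsc I hI⟩, hax, hΩopen, hax, hsc⟩
  simpa [sub_eq_add_neg] using hax x y I (-I) hI (by rw [neg_sq, hI]) h
end
end

section
/- Approximation with interpolation on starlike sets: let Σ ⊂ ℍ be a bounded Jordan region which is starlike with respect to a real point, such that Σ̄ is axially symmetric, the complement of Σ̄ in the one-point compactification of ℍ is connected, and for every unit imaginary quaternion I the complement of Σ̄ ∩ ℂ_I in the one-point compactification of ℂ_I is connected. Let α ∈ Σ̄. If f is slice regular in Σ and continuous on Σ̄, then for every ε > 0 there exists a polynomial P(q) = ∑_{k=0}^n q^k a_k such that P(α) = f(α) and sup_{q ∈ Σ̄} ‖f(q) − P(q)‖ < ε. -/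
noncomputable section

section Runge

variable {E : Type*} [NormedAddCommGroup E] [NormedSpace ℂ E]

/-- `G` can be approximated uniformly on `D` by polynomials with coefficients in `E`. -/
def PolyApprox (D : Set ℂ) (G : ℂ → E) : Prop :=
  ∀ ε > 0, ∃ c : ℕ →₀ E, ∀ z ∈ D, ‖G z - c.sum fun k a => z ^ k • a‖ < ε

theorem PolyApprox.const (D : Set ℂ) (a : E) : PolyApprox D fun _ => a := by
  intro ε hε
  refine ⟨Finsupp.single 0 a, fun z _ => ?_⟩
  rw [Finsupp.sum_single_index (by simp)]
  simpa using hε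

theorem PolyApprox.add {D : Set ℂ} {F G : ℂ → E} (hF : PolyApprox D F) (hG : PolyApprox D G) :
    PolyApprox D fun z => F z + G z := by
  intro ε hε
  obtain ⟨c, hc⟩ := hF (ε / 2) (by positivity)
  obtain ⟨d, hd⟩ := hG (ε / 2) (by positivity)
  refine ⟨c + d, fun z hz => ?_⟩
  rw [Finsupp.sum_add_index' (by simp) (by simp), add_sub_add_comm]
  linarith [norm_add_le (F z - c.sum fun k a => z ^ k • a) (G z - d.sum fun k a => z ^ k • a),
    hc z hz, hd z hz]

theorem PolyApprox.const_smul {D : Set ℂ} {F : ℂ → E} (hF : PolyApprox D F) (w : ℂ) :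
    PolyApprox D fun z => w • F z := by
  intro ε hε
  obtain ⟨c, hc⟩ := hF (ε / (‖w‖ + 1)) (by positivity)
  refine ⟨w • c, fun z hz => ?_⟩
  have : ((w • c).sum fun k a => z ^ k • a) = w • c.sum fun k a => z ^ k • a := by
    rw [Finsupp.sum_smul_index' (by simp), Finsupp.smul_sum]
    simp only [smul_comm w]
  rw [this, ← smul_sub, norm_smul]
  have h := hc z hz
  rw [lt_div_iff₀ (by positivity)] at h
  nlinarith [norm_nonneg (F z - c.sum fun k a => z ^ k • a)]

theorem PolyApprox.id_smul {D : Set ℂ} (hD : Bornology.IsBounded D) {F : ℂ → E}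
    (hF : PolyApprox D F) : PolyApprox D fun z => z • F z := by
  intro ε hε
  obtain ⟨B, hB⟩ := hD.exists_norm_le
  obtain ⟨c, hc⟩ := hF (ε / (|B| + 1)) (by positivity)
  refine ⟨c.mapDomain (· + 1), fun z hz => ?_⟩
  have : ((c.mapDomain (· + 1)).sum fun k a => z ^ k • a) = z • c.sum fun k a => z ^ k • a := by
    rw [Finsupp.sum_mapDomain_index (by simp) (by simp), Finsupp.smul_sum]
    simp only [smul_smul, pow_succ']
  rw [this, ← smul_sub, norm_smul]
  have h := hc z hz
  rw [lt_div_iff₀ (by positivity)] at h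
  nlinarith [norm_nonneg (F z - c.sum fun k a => z ^ k • a), hB z hz, le_abs_self B]

theorem PolyApprox.sub_pow_smul {D : Set ℂ} (hD : Bornology.IsBounded D) {F : ℂ → E}
    (hF : PolyApprox D F) (p : ℂ) (k : ℕ) : PolyApprox D fun z => (z - p) ^ k • F z := by
  induction k with
  | zero => simpa using hF
  | succ k ih =>
    have h := (ih.id_smul hD).add (ih.const_smul (-p))
    have e : (fun z => (z - p) ^ (k + 1) • F z)
        = fun z => z • (z - p) ^ k • F z + (-p) • (z - p) ^ k • F z := by
      funext z
      rw [← add_smul, smul_smul, pow_succ', sub_eq_add_neg]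
    rwa [e]

theorem PolyApprox.sum {D : Set ℂ} {F : ℕ → ℂ → E} (hF : ∀ k, PolyApprox D (F k))
    (s : Finset ℕ) : PolyApprox D fun z => ∑ k ∈ s, F k z := by
  classical
  induction s using Finset.induction_on with
  | empty => simpa using PolyApprox.const D (0 : E)
  | insert a s ha ih => simpa [Finset.sum_insert ha] using (hF a).add ih

theorem PolyApprox.of_forall {D : Set ℂ} {F : ℂ → E}
    (h : ∀ ε > 0, ∃ G, PolyApprox D G ∧ ∀ z ∈ D, ‖F z - G z‖ < ε) : PolyApprox D F := by
  intro ε hε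
  obtain ⟨G, hG, hFG⟩ := h (ε / 2) (by positivity)
  obtain ⟨c, hc⟩ := hG (ε / 2) (by positivity)
  refine ⟨c, fun z hz => ?_⟩
  rw [← sub_add_sub_cancel _ (G z)]
  linarith [norm_add_le (F z - G z) (G z - c.sum fun k a => z ^ k • a), hc z hz, hFG z hz]

theorem DifferentiableOn.iteratedDeriv_of_isOpen [CompleteSpace E] {W : Set ℂ} (hW : IsOpen W)
    {F : ℂ → E} (hF : DifferentiableOn ℂ F W) (k : ℕ) :
    DifferentiableOn ℂ (iteratedDeriv k F) W := by
  induction k with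
  | zero => simpa using hF
  | succ k ih => rw [iteratedDeriv_succ]; exact ih.deriv hW

/-- One step of the propagation of polynomial approximability along dilations. -/
theorem polyApprox_dilation_step [CompleteSpace E] {D W : Set ℂ} (hD : IsCompact D) {p : ℂ}
    (hstar : ∀ z ∈ D, ∀ t ∈ Set.Icc (0 : ℝ) 1, p + t • (z - p) ∈ D) (hW : IsOpen W)
    {r B : ℝ} (hr : 0 < r) (hrW : Metric.cthickening r D ⊆ W) (hB : ∀ z ∈ D, ‖z - p‖ ≤ B)
    {s t : ℝ} (ht : t ∈ Set.Icc (0 : ℝ) 1) (hst : |s - t| * B ≤ r / 2)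
    (h : ∀ H : ℂ → E, DifferentiableOn ℂ H W → PolyApprox D fun z => H (p + t • (z - p)))
    (H : ℂ → E) (hH : DifferentiableOn ℂ H W) :
    PolyApprox D fun z => H (p + s • (z - p)) := by
  obtain ⟨M, hM⟩ := hD.cthickening.exists_bound_of_continuousOn (hH.continuousOn.mono hrW)
  have hball : ∀ w ∈ D, Metric.closedBall w r ⊆ Metric.cthickening r D := fun w hw =>
    Metric.closedBall_subset_cthickening hw r
  set T : ℕ → ℂ → E := fun k z => ((k.factorial : ℂ)⁻¹ * ((s - t : ℝ) : ℂ) ^ k) •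
    (z - p) ^ k • iteratedDeriv k H (p + t • (z - p)) with hT
  have hTA : ∀ k, PolyApprox D (T k) := fun k =>
    ((h _ (hH.iteratedDeriv_of_isOpen hW k)).sub_pow_smul hD.isBounded p k).const_smul _
  have hpt : ∀ z ∈ D, ‖((s - t : ℝ) : ℂ) * (z - p)‖ ≤ r / 2 := by
    intro z hz
    rw [norm_mul, Complex.norm_real, Real.norm_eq_abs]
    exact (mul_le_mul_of_nonneg_left (hB z hz) (abs_nonneg _)).trans hst
  have hsum : ∀ z ∈ D, HasSum (fun k => T k z) (H (p + s • (z - p))) := by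
    intro z hz
    have hw := hstar z hz t ht
    have hd : DifferentiableOn ℂ H (Metric.ball (p + t • (z - p)) r) :=
      hH.mono ((Metric.ball_subset_closedBall.trans (hball _ hw)).trans hrW)
    have e : p + s • (z - p) - (p + t • (z - p)) = ((s - t : ℝ) : ℂ) * (z - p) := by
      simp only [Complex.real_smul]; push_cast; ring
    have := Complex.hasSum_taylorSeries_on_ball hd (z := p + s • (z - p)) (by
      rw [mem_ball_iff_norm, e]
      linarith [hpt z hz])
    convert this using 2 with k
    rw [e, mul_pow]
    simp only [hT, smul_smul]
    rw [mul_assoc]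
  have hbound : ∀ k, ∀ z ∈ D, ‖T k z‖ ≤ |M| * (1 / 2) ^ k := by
    intro k z hz
    have hw := hstar z hz t ht
    have hd : DiffContOnCl ℂ H (Metric.ball (p + t • (z - p)) r) := by
      apply DifferentiableOn.diffContOnCl
      rw [closure_ball _ hr.ne']
      exact hH.mono ((hball _ hw).trans hrW)
    have h1 := Complex.norm_iteratedDeriv_le_of_forall_mem_sphere_norm_le k hr hd (C := |M|)
      (fun w hw' => (hM w (hball _ hw (Metric.sphere_subset_closedBall hw'))).trans (le_abs_self M))
    have h2 : ‖T k z‖ = (k.factorial : ℝ)⁻¹ * ‖((s - t : ℝ) : ℂ) * (z - p)‖ ^ k *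
        ‖iteratedDeriv k H (p + t • (z - p))‖ := by
      simp only [hT, norm_smul, norm_mul, norm_pow, norm_inv, Complex.norm_natCast, mul_pow]
      ring
    rw [h2]
    have h3 := pow_le_pow_left₀ (norm_nonneg _) (hpt z hz) k
    have hk : (0 : ℝ) < k.factorial := by positivity
    calc _ ≤ (k.factorial : ℝ)⁻¹ * (r / 2) ^ k * (k.factorial * |M| / r ^ k) := by gcongr
      _ = |M| * (1 / 2) ^ k := by rw [div_pow, div_pow, one_pow]; field_simp
  have hu : Summable fun k : ℕ => |M| * (1 / 2 : ℝ) ^ k := summable_geometric_two.mul_left _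
  have hunif := tendstoUniformlyOn_tsum_nat hu hbound
  refine PolyApprox.of_forall fun ε hε => ?_
  obtain ⟨n, hn⟩ := (Metric.tendstoUniformlyOn_iff.1 hunif ε hε).exists
  refine ⟨_, PolyApprox.sum hTA (Finset.range n), fun z hz => ?_⟩
  have := hn z hz
  rwa [(hsum z hz).tsum_eq, dist_eq_norm] at this

/-- **Runge's theorem for starlike compact sets.** -/
theorem polyApprox_of_differentiableOn [CompleteSpace E] {D W : Set ℂ} (hD : IsCompact D) {p : ℂ}
    (hstar : ∀ z ∈ D, ∀ t ∈ Set.Icc (0 : ℝ) 1, p + t • (z - p) ∈ D) (hW : IsOpen W)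
    (hDW : D ⊆ W) {F : ℂ → E} (hF : DifferentiableOn ℂ F W) : PolyApprox D F := by
  obtain ⟨r, hr, hrW⟩ := hD.exists_cthickening_subset_open hW hDW
  obtain ⟨B, hB⟩ := hD.exists_bound_of_continuousOn (f := fun z => z - p) (by fun_prop)
  obtain ⟨N, hN⟩ := exists_nat_gt (|B| / (r / 2))
  have hB' : ∀ z ∈ D, ‖z - p‖ ≤ |B| := fun z hz => (hB z hz).trans (le_abs_self B)
  have hN0 : (0 : ℝ) < N := lt_of_le_of_lt (by positivity) hN
  have key : ∀ k : ℕ, k ≤ N → ∀ H : ℂ → E, DifferentiableOn ℂ H W →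
      PolyApprox D fun z => H (p + ((k : ℝ) / N) • (z - p)) := by
    intro k
    induction k with
    | zero => intro _ H _; simpa using PolyApprox.const D (H p)
    | succ k ih =>
      intro hk
      have hk' : (k : ℝ) ≤ N := by exact_mod_cast (Nat.le_of_succ_le hk)
      refine polyApprox_dilation_step hD hstar hW hr hrW hB' (t := (k : ℝ) / N)
        ⟨by positivity, (div_le_one hN0).2 hk'⟩ ?_ (ih (Nat.le_of_succ_le hk))
      have : ((k + 1 : ℕ) : ℝ) / N - k / N = 1 / N := by push_cast; ring
      rw [this, abs_of_pos (by positivity)]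
      rw [div_lt_iff₀ (by positivity)] at hN
      rw [div_mul_eq_mul_div, one_mul, div_le_iff₀ hN0]
      linarith
  have := key N le_rfl F hF
  simpa [div_self hN0.ne'] using this

end Runge

noncomputable section StarlikeJordan

open Set Metric ComplexConjugate

/-- A bounded open planar set, starlike with respect to `0`, whose frontier is a Jordan curve. -/
structure IsStarJordan (V : Set ℂ) : Prop where
  isOpen : IsOpen V
  isBounded : Bornology.IsBounded V
  zero_mem : (0 : ℂ) ∈ V
  star : ∀ z ∈ V, ∀ t ∈ Icc (0 : ℝ) 1, (t : ℂ) * z ∈ V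
  jordan : ∃ γ : Circle → ℂ, Continuous γ ∧ Function.Injective γ ∧ range γ = frontier V

/-- The component of `z` along the unit direction `e`. -/
def dirRe (e z : ℂ) : ℝ := (conj e * z).re

/-- The (signed) slope of `z` with respect to the unit direction `e`. -/
def dirSlope (s : ℝ) (e z : ℂ) : ℝ := s * (conj e * z).im / (conj e * z).re

@[fun_prop]
theorem continuous_dirRe (e : ℂ) : Continuous (dirRe e) := by
  unfold dirRe; fun_prop

theorem continuousAt_dirSlope (s : ℝ) {e z : ℂ} (hz : dirRe e z ≠ 0) :
    ContinuousAt (dirSlope s e) z := by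
  unfold dirSlope
  unfold dirRe at hz
  fun_prop (disch := assumption)

theorem dirRe_ofReal_mul (e z : ℂ) (t : ℝ) : dirRe e (t * z) = t * dirRe e z := by
  simp only [dirRe, Complex.mul_re, Complex.mul_im, Complex.ofReal_re, Complex.ofReal_im]
  ring

theorem dirSlope_ofReal_mul (s : ℝ) (e z : ℂ) {t : ℝ} (ht : t ≠ 0) :
    dirSlope s e (t * z) = dirSlope s e z := by
  have h : conj e * (t * z) = t * (conj e * z) := by ring
  simp only [dirSlope, h, Complex.re_ofReal_mul, Complex.im_ofReal_mul]
  rw [mul_left_comm, mul_div_mul_left _ _ ht]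

theorem conj_mul_self_of_norm_eq_one {e : ℂ} (he : ‖e‖ = 1) : conj e * e = 1 := by
  rw [Complex.conj_mul', he]; simp

theorem dirRe_ofReal_mul_self {e : ℂ} (he : ‖e‖ = 1) (t : ℝ) : dirRe e (t * e) = t := by
  rw [dirRe_ofReal_mul, dirRe, conj_mul_self_of_norm_eq_one he]; simp

theorem dirSlope_ofReal_mul_self (s : ℝ) {e : ℂ} (he : ‖e‖ = 1) (t : ℝ) :
    dirSlope s e (t * e) = 0 := by
  have : conj e * (t * e) = t := by
    rw [mul_left_comm, conj_mul_self_of_norm_eq_one he, mul_one]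
  simp [dirSlope, this]

/-- Points of the same slope in the right half plane are positive multiples of each other. -/
theorem eq_ofReal_mul_of_dirSlope_eq {s : ℝ} (hs : s ≠ 0) {e : ℂ} (he : ‖e‖ = 1) {z w : ℂ}
    (hz : 0 < dirRe e z) (hw : 0 < dirRe e w) (h : dirSlope s e z = dirSlope s e w) :
    z = ((dirRe e z / dirRe e w : ℝ) : ℂ) * w := by
  have he0 : conj e ≠ 0 := by
    intro h0
    have := conj_mul_self_of_norm_eq_one he
    rw [h0, zero_mul] at this
    exact zero_ne_one this
  apply mul_left_cancel₀ he0
  rw [mul_left_comm]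
  unfold dirRe dirSlope at *
  rw [div_eq_div_iff hz.ne' hw.ne', mul_assoc, mul_assoc] at h
  have h := mul_left_cancel₀ hs h
  apply Complex.ext
  · rw [Complex.re_ofReal_mul]; field_simp
  · rw [Complex.im_ofReal_mul]; field_simp; linarith

namespace IsStarJordan

variable {V : Set ℂ} (hV : IsStarJordan V)

include hV

theorem notMem_of_mem_frontier {c : ℂ} (hc : c ∈ frontier V) : c ∉ V := by
  rw [hV.isOpen.frontier_eq] at hc
  exact hc.2

theorem closure_star {z : ℂ} (hz : z ∈ closure V) {t : ℝ} (ht : t ∈ Icc (0 : ℝ) 1) :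
    (t : ℂ) * z ∈ closure V :=
  map_mem_closure (f := fun z => (t : ℂ) * z) (by fun_prop) hz fun w hw => hV.star w hw t ht

theorem dirRe_lt_of_dirSlope_eq {s : ℝ} (hs : s ≠ 0) {e : ℂ} (he : ‖e‖ = 1) {v c : ℂ}
    (hv : v ∈ V) (hc : c ∉ V) (hv0 : 0 < dirRe e v) (hc0 : 0 < dirRe e c)
    (h : dirSlope s e v = dirSlope s e c) : dirRe e v < dirRe e c := by
  by_contra! hlt
  apply hc
  rw [eq_ofReal_mul_of_dirSlope_eq hs he hc0 hv0 h.symm]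
  exact hV.star v hv _ ⟨by positivity, (div_le_one hv0).2 hlt⟩

/-- The frontier is locally connected. -/
theorem exists_preconnected_frontier {c : ℂ} (hc : c ∈ frontier V) {r : ℝ} (hr : 0 < r) :
    ∃ r' > 0, ∃ A, A ⊆ frontier V ∩ ball c r ∧ IsPreconnected A ∧ frontier V ∩ ball c r' ⊆ A := by
  obtain ⟨γ, hγ, hinj, hrange⟩ := hV.jordan
  rw [← hrange] at hc
  obtain ⟨t, rfl⟩ := hc
  have : LocallyConnectedSpace Circle :=
    ChartedSpace.locallyConnectedSpace (EuclideanSpace ℝ (Fin 1)) Circle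
  obtain ⟨N, hN, hNo, htN, hNc⟩ := locallyConnectedSpace_iff_subsets_isOpen_isConnected.1 this t
    (γ ⁻¹' ball (γ t) r) (hγ.continuousAt.preimage_mem_nhds (ball_mem_nhds _ hr))
  have hcl : IsClosed (γ '' Nᶜ) := (hNo.isClosed_compl.isCompact.image hγ).isClosed
  have hnot : γ t ∉ γ '' Nᶜ := by
    rintro ⟨u, hu, hut⟩
    exact hu (hinj hut ▸ htN)
  obtain ⟨r', hr', hball⟩ := Metric.isOpen_iff.1 hcl.isOpen_compl _ hnot
  refine ⟨r', hr', γ '' N, ?_, hNc.isPreconnected.image γ hγ.continuousOn, ?_⟩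
  · rintro _ ⟨u, hu, rfl⟩
    exact ⟨hrange ▸ mem_range_self u, hN hu⟩
  · rintro a ⟨ha, har⟩
    rw [← hrange] at ha
    obtain ⟨u, rfl⟩ := ha
    by_contra hu
    refine hball har ⟨u, fun huN => hu ⟨u, huN, rfl⟩, rfl⟩

/-- Between frontier points close to `c`, the domain does not extend much beyond `c`. -/
theorem exists_ball_dirRe_lt {s : ℝ} (hs : s ≠ 0) {e : ℂ} (he : ‖e‖ = 1) {c : ℂ}
    (hc : c ∈ frontier V) (hc0 : 0 < dirRe e c) {x₁ : ℝ} (hx₁ : dirRe e c < x₁) :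
    ∃ r > 0, ∀ a ∈ frontier V ∩ ball c r, ∀ b ∈ frontier V ∩ ball c r, ∀ v ∈ V, 0 < dirRe e v →
      dirSlope s e a ≤ dirSlope s e v → dirSlope s e v ≤ dirSlope s e b → dirRe e v < x₁ := by
  have hopen : IsOpen (dirRe e ⁻¹' Ioo 0 x₁) := isOpen_Ioo.preimage (continuous_dirRe e)
  obtain ⟨r, hr, hball⟩ := Metric.isOpen_iff.1 hopen c ⟨hc0, hx₁⟩
  obtain ⟨r', hr', A, hA, hAc, hA'⟩ := hV.exists_preconnected_frontier hc hr
  refine ⟨r', hr', fun a ha b hb v hv hv0 h1 h2 => ?_⟩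
  have hcont : ContinuousOn (dirSlope s e) A := fun z hz =>
    (continuousAt_dirSlope s (hball (hA hz).2).1.ne').continuousWithinAt
  obtain ⟨d, hd, hdv⟩ := hAc.intermediate_value (hA' ha) (hA' hb) hcont ⟨h1, h2⟩
  exact (hV.dirRe_lt_of_dirSlope_eq hs he hv (hV.notMem_of_mem_frontier (hA hd).1) hv0
    (hball (hA hd).2).1 hdv.symm).trans (hball (hA hd).2).2

/-- Every segment from `0` to a point outside `V` has a first exit point. -/
theorem exists_exit {w : ℂ} (hw : w ∉ V) : ∃ μ ∈ Ioc (0 : ℝ) 1, (μ : ℂ) * w ∈ frontier V ∧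
    ∀ ν : ℝ, 0 ≤ ν → ν < μ → (ν : ℂ) * w ∈ V := by
  have hcont : Continuous fun t : ℝ => (t : ℂ) * w := by fun_prop
  set K : Set ℝ := Icc 0 1 ∩ (fun t : ℝ => (t : ℂ) * w) ⁻¹' Vᶜ with hK
  have hKc : IsCompact K := isCompact_Icc.inter_right (hV.isOpen.isClosed_compl.preimage hcont)
  have hKn : K.Nonempty := ⟨1, by simp, by simpa using hw⟩
  obtain ⟨μ, hμ, hmin⟩ := hKc.exists_isLeast hKn
  have hμ0 : 0 < μ := by
    rcases hμ.1.1.eq_or_lt with h | h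
    · exact absurd hV.zero_mem (by simpa [← h] using hμ.2)
    · exact h
  have hlt : ∀ ν : ℝ, 0 ≤ ν → ν < μ → (ν : ℂ) * w ∈ V := by
    intro ν h0 hν
    by_contra hn
    exact absurd (hmin ⟨⟨h0, hν.le.trans hμ.1.2⟩, hn⟩) (not_le.2 hν)
  refine ⟨μ, ⟨hμ0, hμ.1.2⟩, ?_, hlt⟩
  rw [hV.isOpen.frontier_eq]
  refine ⟨?_, hμ.2⟩
  have hm : μ ∈ closure (Ico 0 μ) := by rw [closure_Ico hμ0.ne]; exact ⟨hμ0.le, le_rfl⟩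
  exact map_mem_closure (f := fun t : ℝ => (t : ℂ) * w) hcont hm fun ν hν => hlt ν hν.1 hν.2

/-- The frontier is not a radial slit near any of its points. -/
theorem not_slit {c : ℂ} (hc : c ∈ frontier V) {r : ℝ} (hr : 0 < r)
    (h : ∀ a ∈ frontier V ∩ ball c r, ∃ x : ℝ, 1 ≤ x ∧ a = x * c) : False := by
  have hc0 : c ≠ 0 := by
    rintro rfl
    exact hV.notMem_of_mem_frontier hc hV.zero_mem
  obtain ⟨γ, hγ, hinj, hrange⟩ := hV.jordan
  obtain ⟨t, ht⟩ : c ∈ range γ := hrange ▸ hc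
  obtain ⟨θ, rfl⟩ := Circle.exp_surjective t
  have hcont : Continuous fun θ : ℝ => γ (Circle.exp θ) := by fun_prop
  obtain ⟨δ, hδ, hball⟩ := Metric.isOpen_iff.1 (isOpen_ball.preimage hcont) θ
    (show θ ∈ (fun θ : ℝ => γ (Circle.exp θ)) ⁻¹' ball c r by simpa [ht] using hr)
  set κ := min (δ / 2) 1 with hκ
  have hκ0 : 0 < κ := by positivity
  have hmem : ∀ u ∈ Icc (θ - κ) (θ + κ), ∃ x : ℝ, 1 ≤ x ∧ γ (Circle.exp u) = x * c := by
    intro u hu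
    refine h _ ⟨hrange ▸ mem_range_self _, hball ?_⟩
    rw [mem_ball, Real.dist_eq, abs_lt]
    have := min_le_left (δ / 2) 1
    constructor <;> linarith [hu.1, hu.2]
  set g : ℝ → ℝ := fun u => (γ (Circle.exp u) / c).re with hg
  have hgx : ∀ {u : ℝ} {x : ℝ}, γ (Circle.exp u) = x * c → g u = x := by
    intro u x hx
    simp [hg, hx, hc0]
  have hg1 : g θ = 1 := hgx (by simp [ht])
  have hge : ∀ u ∈ Icc (θ - κ) (θ + κ), 1 ≤ g u := by
    intro u hu
    obtain ⟨x, hx, hux⟩ := hmem u hu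
    rwa [hgx hux]
  have hgc : ContinuousOn g (Icc (θ - κ) (θ + κ)) :=
    (Complex.continuous_re.comp (hcont.div_const c)).continuousOn
  have hgi : InjOn g (Icc (θ - κ) (θ + κ)) := by
    intro u hu v hv huv
    obtain ⟨x, -, hux⟩ := hmem u hu
    obtain ⟨y, -, hvy⟩ := hmem v hv
    rw [hgx hux, hgx hvy] at huv
    refine Circle.exp_injOn_Icc (a := θ - κ) (b := θ + κ) ?_ hu hv (hinj ?_)
    · have := min_le_right (δ / 2) 1
      linarith [Real.pi_gt_three]
    · rw [hux, hvy, huv]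
  have hm : θ ∈ Icc (θ - κ) (θ + κ) := ⟨by linarith, by linarith⟩
  rcases hgc.strictMonoOn_of_injOn_Icc' (by linarith) hgi with hmono | hanti
  · have hl : θ - κ ∈ Icc (θ - κ) (θ + κ) := ⟨le_rfl, by linarith⟩
    linarith [hmono hl hm (by linarith), hge _ hl]
  · have hl : θ + κ ∈ Icc (θ - κ) (θ + κ) := ⟨by linarith, le_rfl⟩
    linarith [hanti hm hl (by linarith), hge _ hl]

end IsStarJordan
end StarlikeJordan

noncomputable section StarlikeJordan
open Set Metric ComplexConjugate Filter Topology
namespace IsStarJordan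

variable {V : Set ℂ} (hV : IsStarJordan V)
include hV

theorem isCompact_closure : IsCompact (closure V) := hV.isBounded.isCompact_closure

/-- If the domain reaches the tip `T e` of `closure V` from the side of positive slope, then a
point of `closure V` on the ray of `e`, pushed to that side and shrunk by `l`, lands in `V`. -/
theorem exists_push {e : ℂ} (he : ‖e‖ = 1) {l : ℝ} (hl0 : 0 < l) (hl1 : l < 1) {s : ℝ}
    (hs : s ≠ 0) {T : ℝ} (htop : ∀ x : ℝ, (x * e : ℂ) ∈ closure V → x ≤ T)
    (hside : ∀ ρ > 0, ∃ v ∈ V ∩ ball (T * e : ℂ) ρ, 0 < dirSlope s e v)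
    {x : ℝ} (hx0 : 0 < x) (hx : (x * e : ℂ) ∈ closure V) :
    ∃ ρ > 0, ∀ z ∈ closure V ∩ ball (x * e : ℂ) ρ, ∀ w ∈ ball ((l * x : ℝ) * e : ℂ) ρ,
      dirSlope s e z < dirSlope s e w → w ∈ V := by
  by_contra! hcon
  set x₁ : ℝ := (l * x + x) / 2 with hx₁
  have hlxx : l * x < x := by nlinarith
  have hlx0 : 0 < l * x := by positivity
  have hx₁0 : 0 < x₁ := by positivity
  -- sequences of points violating the claim
  have hseq : ∀ n : ℕ, ∃ z w, z ∈ V ∧ x₁ < dirRe e z ∧ dist z (x * e : ℂ) < 1 / (n + 1) ∧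
      w ∉ V ∧ 0 < dirRe e w ∧ dist w ((l * x : ℝ) * e : ℂ) < 1 / (n + 1) ∧
      dirSlope s e z < dirSlope s e w := by
    intro n
    have h1 : ∀ᶠ z in 𝓝 (x * e : ℂ), x₁ < dirRe e z := by
      apply (continuous_dirRe e).continuousAt.eventually_const_lt
      rw [dirRe_ofReal_mul_self he]; linarith
    have h2 : ∀ᶠ z in 𝓝 ((l * x : ℝ) * e : ℂ), 0 < dirRe e z := by
      apply (continuous_dirRe e).continuousAt.eventually_const_lt
      rw [dirRe_ofReal_mul_self he]; exact hlx0
    obtain ⟨ρ₁, hρ₁, h1⟩ := Metric.eventually_nhds_iff.1 h1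
    obtain ⟨ρ₂, hρ₂, h2⟩ := Metric.eventually_nhds_iff.1 h2
    have hn : (0 : ℝ) < 1 / (n + 1) := by positivity
    obtain ⟨z, ⟨hz, hzb⟩, w, hwb, hzw, hw⟩ := hcon (min (min ρ₁ ρ₂) (1 / (n + 1))) (by positivity)
    rw [mem_ball, lt_min_iff, lt_min_iff] at hzb hwb
    have hz0 := h1 hzb.1.1
    have hev : ∀ᶠ y in 𝓝 z, x₁ < dirRe e y ∧ dist y (x * e : ℂ) < 1 / (n + 1) ∧
        dirSlope s e y < dirSlope s e w := by
      refine ((continuous_dirRe e).continuousAt.eventually_const_lt hz0).and (.and ?_ ?_)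
      · exact (continuous_id.dist continuous_const).continuousAt.eventually_lt_const hzb.2
      · exact (continuousAt_dirSlope s (by linarith)).eventually_lt_const hzw
    obtain ⟨y, hyV, hy⟩ := ((mem_closure_iff_frequently.1 hz).and_eventually hev).exists
    exact ⟨y, w, hyV, hy.1, hy.2.1, hw, h2 hwb.1.2, hwb.2, hy.2.2⟩
  choose z w hzV hzx hzd hwV hwx hwd hzw using hseq
  choose μ hμ hμf hμlt using fun n => hV.exists_exit (hwV n)
  obtain ⟨m, hm, φ, hφ, hμm⟩ := isCompact_Icc.tendsto_subseq
    fun n => (⟨(hμ n).1.le, (hμ n).2⟩ : μ n ∈ Icc (0 : ℝ) 1)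
  have hlim : Tendsto (fun n => z n) atTop (𝓝 (x * e : ℂ)) :=
    tendsto_iff_dist_tendsto_zero.2 (squeeze_zero (fun _ => dist_nonneg) (fun n => (hzd n).le)
      tendsto_one_div_add_atTop_nhds_zero_nat)
  have hlimw : Tendsto (fun n => w n) atTop (𝓝 ((l * x : ℝ) * e : ℂ)) :=
    tendsto_iff_dist_tendsto_zero.2 (squeeze_zero (fun _ => dist_nonneg) (fun n => (hwd n).le)
      tendsto_one_div_add_atTop_nhds_zero_nat)
  set c : ℕ → ℂ := fun n => (μ n : ℂ) * w n with hc
  have hclim : Tendsto (fun n => c (φ n)) atTop (𝓝 ((m * (l * x) : ℝ) * e : ℂ)) := by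
    have h1 : Tendsto (fun n => ((μ (φ n) : ℝ) : ℂ)) atTop (𝓝 (m : ℂ)) :=
      (Complex.continuous_ofReal.tendsto m).comp hμm
    have := h1.mul (hlimw.comp hφ.tendsto_atTop)
    simpa [hc, mul_assoc] using this
  have hcf : ((m * (l * x) : ℝ) * e : ℂ) ∈ frontier V :=
    isClosed_frontier.mem_of_tendsto hclim (Eventually.of_forall fun n => hμf _)
  have hm0 : 0 < m := by
    rcases hm.1.eq_or_lt with h | h
    · rw [← h] at hcf
      exact absurd hV.zero_mem (hV.notMem_of_mem_frontier (by simpa using hcf))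
    · exact h
  have hcre : dirRe e ((m * (l * x) : ℝ) * e : ℂ) = m * (l * x) := dirRe_ofReal_mul_self he _
  have hcx₁ : m * (l * x) < x₁ := by
    have : m * (l * x) ≤ l * x := mul_le_of_le_one_left hlx0.le hm.2
    linarith
  obtain ⟨r, hr, halt⟩ := hV.exists_ball_dirRe_lt hs he hcf (by rw [hcre]; positivity)
    (x₁ := x₁) (by rw [hcre]; exact hcx₁)
  have hcslope : ∀ n, dirSlope s e (c n) = dirSlope s e (w n) := fun n =>
    dirSlope_ofReal_mul s e _ (hμ n).1.ne'
  have hcpos : ∀ n, 0 < dirRe e (c n) := fun n => by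
    rw [hc]; dsimp only; rw [dirRe_ofReal_mul]; exact mul_pos (hμ n).1 (hwx n)
  obtain ⟨N, hN⟩ := (hclim.eventually (ball_mem_nhds _ hr)).exists_forall_of_atTop
  have hcmem : ∀ n ≥ N, c (φ n) ∈ frontier V ∩ ball ((m * (l * x) : ℝ) * e : ℂ) r := fun n hn =>
    ⟨hμf _, hN n hn⟩
  have hcs : Tendsto (fun n => dirSlope s e (c (φ n))) atTop (𝓝 0) := by
    have := (continuousAt_dirSlope s (e := e) (z := ((m * (l * x) : ℝ) * e : ℂ))
      (by rw [hcre]; positivity)).tendsto.comp hclim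
    rwa [dirSlope_ofReal_mul_self s he] at this
  have hzs : Tendsto (fun n => dirSlope s e (z (φ n))) atTop (𝓝 0) := by
    have := (continuousAt_dirSlope s (e := e) (z := (x * e : ℂ))
      (by rw [dirRe_ofReal_mul_self he]; positivity)).tendsto.comp (hlim.comp hφ.tendsto_atTop)
    rwa [dirSlope_ofReal_mul_self s he] at this
  -- no frontier point near the limit has positive slope
  have hpos : ∀ a ∈ frontier V ∩ ball ((m * (l * x) : ℝ) * e : ℂ) r,
      dirSlope s e a ≤ 0 := by
    intro a ha
    by_contra! ha0
    have hxT : x ≤ T := htop x hx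
    have hT0 : dirRe e (T * e : ℂ) = T := dirRe_ofReal_mul_self he T
    have h1 : ∀ᶠ v in 𝓝 (T * e : ℂ), x₁ < dirRe e v :=
      (continuous_dirRe e).continuousAt.eventually_const_lt (by rw [hT0]; linarith)
    have h2 : ∀ᶠ v in 𝓝 (T * e : ℂ), dirSlope s e v < dirSlope s e a :=
      (continuousAt_dirSlope s (by rw [hT0]; linarith)).eventually_lt_const
        (by rwa [dirSlope_ofReal_mul_self s he])
    obtain ⟨ρ, hρ, h⟩ := Metric.eventually_nhds_iff.1 (h1.and h2)
    obtain ⟨v, ⟨hvV, hvb⟩, hv0⟩ := hside ρ hρ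
    obtain ⟨hv1, hv2⟩ := h hvb
    obtain ⟨n, hn1, hn2⟩ := ((hcs.eventually_lt_const hv0).and (eventually_ge_atTop N)).exists
    exact absurd (halt _ (hcmem n hn2) a ha v hvV (by linarith) hn1.le hv2.le) (by linarith)
  have hneg : ∀ a ∈ frontier V ∩ ball ((m * (l * x) : ℝ) * e : ℂ) r, 0 ≤ dirSlope s e a := by
    intro a ha
    by_contra! ha0
    obtain ⟨n, hn1, hn2⟩ := ((hzs.eventually_const_lt ha0).and (eventually_ge_atTop N)).exists
    exact absurd (halt a ha _ (hcmem n hn2) _ (hzV _) (by linarith [hzx (φ n)]) hn1.le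
      (by rw [hcslope]; exact (hzw _).le)) (by linarith [hzx (φ n)])
  have hzero : ∀ a ∈ frontier V ∩ ball ((m * (l * x) : ℝ) * e : ℂ) r, dirSlope s e a = 0 :=
    fun a ha => le_antisymm (hpos a ha) (hneg a ha)
  have hev : ∀ᶠ a in 𝓝 (c (φ N)), a ∈ ball ((m * (l * x) : ℝ) * e : ℂ) r ∧ 0 < dirRe e a :=
    (isOpen_ball.eventually_mem (hN N le_rfl)).and
      ((continuous_dirRe e).continuousAt.eventually_const_lt (hcpos _))
  obtain ⟨r', hr', hball⟩ := Metric.eventually_nhds_iff.1 hev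
  refine hV.not_slit (hμf (φ N)) hr' fun a ha => ?_
  obtain ⟨ha1, ha2⟩ := hball ha.2
  have hac := eq_ofReal_mul_of_dirSlope_eq hs he ha2 (hcpos (φ N))
    ((hzero a ⟨ha.1, ha1⟩).trans (hzero _ (hcmem N le_rfl)).symm)
  refine ⟨_, ?_, hac⟩
  by_contra! hlt
  apply hV.notMem_of_mem_frontier ha.1
  rw [hac, hc]
  dsimp only
  rw [← mul_assoc, ← Complex.ofReal_mul]
  have h0 : 0 < dirRe e a / dirRe e (c (φ N)) := div_pos ha2 (hcpos _)
  exact hμlt _ _ (mul_nonneg h0.le (hμ _).1.le) (mul_lt_of_lt_one_left (hμ _).1 hlt)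

/-- Only finitely many radii of `closure V` fail to be shrunk into `V` by the factor `l`. -/
theorem finite_bad_directions {l : ℝ} (hl0 : 0 < l) (hl1 : l < 1) :
    {e : ℂ | ‖e‖ = 1 ∧ ∃ x : ℝ, 0 < x ∧ (x * e : ℂ) ∈ closure V ∧
      ((l * x : ℝ) * e : ℂ) ∉ V}.Finite := by
  by_contra hinf
  set d := Set.Infinite.natEmbedding _ hinf with hd
  have hprop : ∀ n, ‖(d n : ℂ)‖ = 1 ∧ ∃ x : ℝ, 0 < x ∧ (x * (d n : ℂ) : ℂ) ∈ closure V ∧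
      ((l * x : ℝ) * (d n : ℂ) : ℂ) ∉ V := fun n => (d n).2
  choose hd1 x hx0 hxV hlx using hprop
  choose μ hμ hμf _ using fun n => hV.exists_exit (hlx n)
  obtain ⟨⟨z, m⟩, ⟨hz, hm⟩, φ, hφ, hlim⟩ := (hV.isCompact_closure.prod isCompact_Icc).tendsto_subseq
    fun n => (⟨hxV n, (hμ n).1.le, (hμ n).2⟩ :
      ((x n * (d n : ℂ) : ℂ), μ n) ∈ closure V ×ˢ Icc (0 : ℝ) 1)
  replace hz : z ∈ closure V := hz
  replace hm : m ∈ Icc (0 : ℝ) 1 := hm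
  have hlimz : Tendsto (fun n => (x (φ n) * (d (φ n) : ℂ) : ℂ)) atTop (𝓝 z) :=
    (continuous_fst.tendsto _).comp hlim
  have hlimm : Tendsto (fun n => μ (φ n)) atTop (𝓝 m) := (continuous_snd.tendsto _).comp hlim
  have hlz : (l : ℂ) * z ∉ V := by
    refine hV.isOpen.isClosed_compl.mem_of_tendsto (hlimz.const_mul (l : ℂ))
      (Eventually.of_forall fun n => ?_)
    have := hlx (φ n)
    rwa [Complex.ofReal_mul, mul_assoc] at this
  have hz0 : z ≠ 0 := by
    rintro rfl
    exact hlz (by simpa using hV.zero_mem)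
  have hnz : 0 < ‖z‖ := norm_pos_iff.2 hz0
  set e : ℂ := ((‖z‖⁻¹ : ℝ) : ℂ) * z with he'
  have he : ‖e‖ = 1 := by
    rw [he', norm_mul, Complex.norm_real, norm_inv, norm_norm, inv_mul_cancel₀ hnz.ne']
  have hze : z = (‖z‖ : ℂ) * e := by
    rw [he', ← mul_assoc, ← Complex.ofReal_mul, mul_inv_cancel₀ hnz.ne']; simp
  have hrez : dirRe e z = ‖z‖ := by
    conv_lhs => rw [hze]
    exact dirRe_ofReal_mul_self he _
  set c : ℕ → ℂ := fun n => (μ n : ℂ) * ((l * x n : ℝ) * (d n : ℂ)) with hc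
  have hclim : Tendsto (fun n => c (φ n)) atTop (𝓝 ((m * l : ℝ) * z : ℂ)) := by
    have h1 : Tendsto (fun n => ((μ (φ n) : ℝ) : ℂ)) atTop (𝓝 (m : ℂ)) :=
      (Complex.continuous_ofReal.tendsto m).comp hlimm
    have := h1.mul (hlimz.const_mul (l : ℂ))
    simpa [hc, mul_assoc] using this
  have hcf : ((m * l : ℝ) * z : ℂ) ∈ frontier V :=
    isClosed_frontier.mem_of_tendsto hclim (Eventually.of_forall fun n => hμf _)
  have hm0 : 0 < m := by
    rcases hm.1.eq_or_lt with h | h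
    · rw [← h] at hcf
      exact absurd hV.zero_mem (hV.notMem_of_mem_frontier (by simpa using hcf))
    · exact h
  have hcre : dirRe e ((m * l : ℝ) * z : ℂ) = m * l * ‖z‖ := by rw [dirRe_ofReal_mul, hrez]
  have hml : m * l < 1 := (mul_le_of_le_one_left hl0.le hm.2).trans_lt hl1
  obtain ⟨x₁, h1, h2⟩ := exists_between (mul_lt_of_lt_one_left hnz hml)
  obtain ⟨r, hr, halt⟩ := hV.exists_ball_dirRe_lt one_ne_zero he hcf
    (by rw [hcre]; positivity) (x₁ := x₁) (by rw [hcre]; exact h1)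
  have hx₁0 : 0 < x₁ := lt_trans (by positivity) h1
  have htail : ∀ᶠ n in atTop, c (φ n) ∈ ball ((m * l : ℝ) * z : ℂ) r ∧
      x₁ < dirRe e (x (φ n) * (d (φ n) : ℂ) : ℂ) :=
    (hclim.eventually_mem (ball_mem_nhds _ hr)).and
      (((continuous_dirRe e).tendsto z).comp hlimz |>.eventually_const_lt (by rwa [hrez]))
  obtain ⟨N, hN⟩ := htail.exists_forall_of_atTop
  set σ : ℕ → ℝ := fun n => dirSlope 1 e (d (φ n) : ℂ) with hσ
  have hσz : ∀ n, dirSlope 1 e (x (φ n) * (d (φ n) : ℂ) : ℂ) = σ n := fun n =>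
    dirSlope_ofReal_mul 1 e _ (hx0 _).ne'
  have hσc : ∀ n, dirSlope 1 e (c (φ n)) = σ n := fun n => by
    rw [hc]; dsimp only
    rw [dirSlope_ofReal_mul _ _ _ (hμ _).1.ne',
      dirSlope_ofReal_mul _ _ _ (mul_pos hl0 (hx0 _)).ne']
  have hdpos : ∀ n ≥ N, 0 < dirRe e (d (φ n) : ℂ) := by
    intro n hn
    have := hx₁0.trans (hN n hn).2
    rw [dirRe_ofReal_mul] at this
    exact pos_of_mul_pos_right this (hx0 _).le
  have key : ∀ n ≥ N, ∀ k ≥ N, ∀ j ≥ N, σ n < σ k → σ k < σ j → False := by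
    intro n hn k hk j hj hnk hkj
    have hzk := (hN k hk).2
    have hcont := continuousAt_dirSlope 1 (e := e) (hx₁0.trans hzk).ne'
    have hev := ((continuous_dirRe e).continuousAt.eventually_const_lt hzk).and
      ((hcont.eventually_const_lt (by rwa [hσz])).and (hcont.eventually_lt_const (by rwa [hσz])))
    obtain ⟨v, hvV, hv, hv1, hv2⟩ :=
      ((mem_closure_iff_frequently.1 (hxV (φ k))).and_eventually hev).exists
    exact absurd (halt (c (φ n)) ⟨hμf _, (hN n hn).1⟩ (c (φ j)) ⟨hμf _, (hN j hj).1⟩ v hvV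
      (by linarith) (by rw [hσc]; exact hv1.le) (by rw [hσc]; exact hv2.le)) (by linarith)
  have hne : ∀ n ≥ N, ∀ k ≥ N, n ≠ k → σ n ≠ σ k := by
    intro n hn k hk hnk heq
    have h := eq_ofReal_mul_of_dirSlope_eq one_ne_zero he (hdpos n hn) (hdpos k hk) heq
    have hpos := div_pos (hdpos n hn) (hdpos k hk)
    have h' := congrArg norm h
    rw [norm_mul, hd1, hd1, mul_one, Complex.norm_real, Real.norm_of_nonneg hpos.le] at h'
    rw [← h', Complex.ofReal_one, one_mul] at h
    exact hnk (hφ.injective (d.injective (Subtype.ext h)))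
  have ha := hne N le_rfl (N + 1) (by omega) (by omega)
  have hb := hne N le_rfl (N + 2) (by omega) (by omega)
  have hc := hne (N + 1) (by omega) (N + 2) (by omega) (by omega)
  have k0 : N ≥ N := le_rfl
  have k1 : N + 1 ≥ N := by omega
  have k2 : N + 2 ≥ N := by omega
  rcases lt_or_gt_of_ne ha with ha | ha <;> rcases lt_or_gt_of_ne hb with hb | hb <;>
    rcases lt_or_gt_of_ne hc with hc | hc
  · exact key _ k0 _ k1 _ k2 ha hc
  · exact key _ k0 _ k2 _ k1 hb hc
  · linarith
  · exact key _ k2 _ k0 _ k1 hb ha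
  · exact key _ k1 _ k0 _ k2 ha hb
  · linarith
  · exact key _ k1 _ k2 _ k0 hc hb
  · exact key _ k2 _ k1 _ k0 hc ha

end IsStarJordan
end StarlikeJordan

noncomputable section StarlikeJordan
open Set Metric ComplexConjugate Filter Topology

/-- Finitely many unit complex numbers have a common power arbitrarily close to `1`. -/
theorem exists_pow_near_one (Θ : Finset ℂ) (hΘ : ∀ e ∈ Θ, ‖e‖ = 1) {τ : ℝ} (hτ : 0 < τ) :
    ∃ M : ℕ, 0 < M ∧ ∀ e ∈ Θ, ‖e ^ M - 1‖ < τ := by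
  have hmem : ∀ n : ℕ, (fun e : Θ => (e : ℂ) ^ n) ∈ closedBall (0 : Θ → ℂ) 1 := fun n => by
    rw [mem_closedBall_zero_iff, pi_norm_le_iff_of_nonneg zero_le_one]
    intro e
    rw [norm_pow, hΘ e e.2, one_pow]
  obtain ⟨u, -, φ, hφ, hlim⟩ := (isCompact_closedBall (0 : Θ → ℂ) 1).tendsto_subseq hmem
  obtain ⟨N, hN⟩ := Metric.cauchySeq_iff'.1 hlim.cauchySeq τ hτ
  have hlt : φ N < φ (N + 1) := hφ (Nat.lt_succ_self N)
  refine ⟨φ (N + 1) - φ N, by omega, fun e he => ?_⟩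
  have h := (dist_pi_lt_iff hτ).1 (hN (N + 1) (by omega)) ⟨e, he⟩
  simp only [Function.comp_apply, dist_eq_norm] at h
  have hfac : e ^ φ (N + 1) - e ^ φ N = e ^ φ N * (e ^ (φ (N + 1) - φ N) - 1) := by
    rw [mul_sub, ← pow_add, Nat.add_sub_cancel' hlt.le, mul_one]
  rwa [hfac, norm_mul, norm_pow, hΘ e he, one_pow, one_mul] at h

/-- A polynomial that is nearly constant, with value `e`, along finitely many rays `ℝ₊ e`, away
from `0` and `∞`. -/
theorem exists_entire_near_direction (Θ : Finset ℂ) (hΘ : ∀ e ∈ Θ, ‖e‖ = 1) {δ B τ : ℝ}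
    (hδ : 0 < δ) (hτ : 0 < τ) :
    ∃ p : ℂ → ℂ, Differentiable ℂ p ∧
      ∀ e ∈ Θ, ∀ x ∈ Icc δ B, ‖p (x * e : ℂ) - e‖ < τ := by
  rcases lt_or_ge B δ with hB | hB
  · exact ⟨id, differentiable_id, fun e _ x hx => absurd (hx.1.trans hx.2) (not_le.2 hB)⟩
  have hB0 : 0 < B := hδ.trans_le hB
  -- `‖w - 1‖ < τ₁` makes every power `w ^ (-β)`, `β ∈ [0, 1]`, close to `1`
  have hlog : ∀ᶠ w : ℂ in 𝓝 1, ‖Complex.log w‖ < min 1 (τ / 4) := by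
    have : ContinuousAt (fun w : ℂ => ‖Complex.log w‖) 1 :=
      (continuousAt_clog Complex.one_mem_slitPlane).norm
    exact this.eventually_lt_const (by simp [hτ])
  obtain ⟨τ₁, hτ₁, hlog⟩ := Metric.eventually_nhds_iff.1 hlog
  obtain ⟨M, hM, hpow⟩ := exists_pow_near_one Θ hΘ (lt_min hτ₁ (by norm_num : (0 : ℝ) < 1 / 2))
  set D : Set ℂ := {ζ | δ ^ M / 2 ≤ ζ.re} ∩ closedBall 0 (B ^ M) with hD
  have hDc : IsCompact D := (isCompact_closedBall _ _).inter_left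
    (isClosed_le continuous_const Complex.continuous_re)
  have hDconv : Convex ℝ D :=
    (convex_halfSpace_re_ge _).inter (convex_closedBall _ _)
  have hpD : ((B ^ M : ℝ) : ℂ) ∈ D := by
    have h1 : δ ^ M ≤ B ^ M := by gcongr
    have h2 : 0 < δ ^ M := by positivity
    refine ⟨?_, ?_⟩
    · rw [mem_ofPred_eq, Complex.ofReal_re]; linarith
    · rw [mem_closedBall_zero_iff, Complex.norm_real, Real.norm_of_nonneg (by positivity)]
  have happ : PolyApprox D fun ζ : ℂ => ζ ^ (-(1 / M : ℝ) : ℂ) := by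
    refine polyApprox_of_differentiableOn hDc (p := ((B ^ M : ℝ) : ℂ))
      (fun z hz t ht => ?_) Complex.isOpen_slitPlane (W := Complex.slitPlane) (fun z hz => ?_)
      (fun z hz => ?_)
    · exact hDconv.add_smul_sub_mem hpD hz ht
    · exact Or.inl (lt_of_lt_of_le (by positivity) hz.1)
    · exact (differentiableAt_id.cpow (differentiableAt_const _) hz).differentiableWithinAt
  obtain ⟨c, hc⟩ := happ (τ / (2 * B)) (by positivity)
  refine ⟨fun z => z * c.sum fun k a => (z ^ M) ^ k • a, ?_, fun e he x hx => ?_⟩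
  · unfold Finsupp.sum; fun_prop
  have hx0 : 0 < x := hδ.trans_le hx.1
  set w : ℂ := e ^ M with hw
  obtain ⟨hw1, hw2⟩ := lt_min_iff.1 (hpow e he)
  have hzM : (x * e : ℂ) ^ M = ((x ^ M : ℝ) : ℂ) * w := by rw [mul_pow, Complex.ofReal_pow]
  have hwre : 1 / 2 ≤ w.re := by
    have := (Complex.abs_re_le_norm (w - 1)).trans hw2.le
    rw [Complex.sub_re, Complex.one_re, abs_le] at this
    linarith
  have hw0 : w ≠ 0 := by
    intro h0
    rw [h0, Complex.zero_re] at hwre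
    norm_num at hwre
  have hmemD : (x * e : ℂ) ^ M ∈ D := by
    refine ⟨?_, ?_⟩
    · have h1 : δ ^ M ≤ x ^ M := by gcongr; exact hx.1
      have h2 : 0 < δ ^ M := by positivity
      rw [mem_ofPred_eq, hzM, Complex.re_ofReal_mul]
      nlinarith
    · rw [mem_closedBall_zero_iff, norm_pow, norm_mul, hΘ e he, Complex.norm_real,
        Real.norm_of_nonneg hx0.le, mul_one]
      gcongr
      exact hx.2
  have h1 := hc _ hmemD
  have hM0 : (M : ℝ) ≠ 0 := by positivity
  have hcpow : ((x * e : ℂ) ^ M) ^ (-(1 / M : ℝ) : ℂ) = (x : ℂ)⁻¹ * w ^ (-(1 / M : ℝ) : ℂ) := by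
    have hxM : 0 < x ^ M := by positivity
    rw [hzM, Complex.cpow_def_of_ne_zero (by simp [hx0.ne', hw0]),
      Complex.cpow_def_of_ne_zero hw0, Complex.log_ofReal_mul hxM hw0, add_mul, Complex.exp_add,
      Real.log_pow]
    congr 1
    rw [← Complex.ofReal_neg, ← Complex.ofReal_mul, ← Complex.ofReal_inv, ← Complex.ofReal_exp]
    congr 1
    rw [show (M * Real.log x) * -(1 / (M : ℝ)) = -Real.log x by field_simp, Real.exp_neg,
      Real.exp_log hx0]
  have h2 : ‖w ^ (-(1 / M : ℝ) : ℂ) - 1‖ < τ / 2 := by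
    obtain ⟨hl1, hl2⟩ := lt_min_iff.1 (hlog (y := w) (by rwa [dist_eq_norm]))
    have hle : ‖Complex.log w * (-(1 / M : ℝ) : ℂ)‖ ≤ ‖Complex.log w‖ := by
      rw [norm_mul, norm_neg, Complex.norm_real]
      refine mul_le_of_le_one_right (norm_nonneg _) ?_
      rw [Real.norm_of_nonneg (by positivity)]
      exact (div_le_one (by positivity)).2 (by exact_mod_cast hM)
    rw [Complex.cpow_def_of_ne_zero hw0]
    have := Complex.norm_exp_sub_one_le (hle.trans hl1.le)
    linarith
  set y := c.sum fun k a => ((x * e : ℂ) ^ M) ^ k • a with hy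
  have hxe : ‖(x * e : ℂ)‖ = x := by
    rw [norm_mul, hΘ e he, Complex.norm_real, Real.norm_of_nonneg hx0.le, mul_one]
  have hsplit : (x * e : ℂ) * y - e = e * (w ^ (-(1 / M : ℝ) : ℂ) - 1)
      - (x * e : ℂ) * (((x * e : ℂ) ^ M) ^ (-(1 / M : ℝ) : ℂ) - y) := by
    rw [hcpow]
    have : (x : ℂ) ≠ 0 := by exact_mod_cast hx0.ne'
    field_simp
    ring
  change ‖(x * e : ℂ) * y - e‖ < τ
  rw [hsplit]
  refine (norm_sub_le _ _).trans_lt ?_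
  rw [norm_mul, norm_mul, hxe, hΘ e he, one_mul]
  have h3 : x * ‖((x * e : ℂ) ^ M) ^ (-(1 / M : ℝ) : ℂ) - y‖ ≤ B * (τ / (2 * B)) :=
    mul_le_mul hx.2 h1.le (norm_nonneg _) hB0.le
  have h4 : B * (τ / (2 * B)) = τ / 2 := by field_simp
  linarith

/-- An entire function whose real part has prescribed signs along finitely many rays. -/
theorem exists_entire_re_sign (Θ : Finset ℂ) (hΘ : ∀ e ∈ Θ, ‖e‖ = 1) (s : ℂ → ℝ)
    (hs : ∀ e ∈ Θ, s e ≠ 0) {δ B : ℝ} (hδ : 0 < δ) :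
    ∃ h : ℂ → ℂ, Differentiable ℂ h ∧ ∀ e ∈ Θ, ∀ x ∈ Icc δ B, 0 < s e * (h (x * e : ℂ)).re := by
  set Q := Lagrange.interpolate Θ id fun e => (s e : ℂ) with hQ
  have hQe : ∀ e ∈ Θ, Q.eval e = s e := fun e he =>
    Lagrange.eval_interpolate_at_node (v := id) _ (Function.injective_id.injOn) he
  have hev : ∀ᶠ v : ℂ in 𝓝 0, ∀ e ∈ Θ, 0 < s e * (Q.eval (e + v)).re := by
    rw [Filter.eventually_all_finset]
    intro e he
    have hcont : ContinuousAt (fun v : ℂ => s e * (Q.eval (e + v)).re) 0 := by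
      refine Continuous.continuousAt ?_
      have := Q.continuous
      fun_prop
    refine hcont.eventually_const_lt ?_
    simpa [hQe e he] using mul_self_pos.2 (hs e he)
  obtain ⟨τ, hτ, hball⟩ := Metric.eventually_nhds_iff.1 hev
  obtain ⟨p, hp, hpe⟩ := exists_entire_near_direction Θ hΘ (B := B) hδ hτ
  refine ⟨fun z => Q.eval (p z), Q.differentiable.comp hp, fun e he x hx => ?_⟩
  have := hball (y := p (x * e : ℂ) - e) (by simpa using hpe e he x hx) e he
  simpa using this

namespace IsStarJordan

variable {V : Set ℂ} (hV : IsStarJordan V)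
include hV

/-- Above a radius that `l` fails to shrink into `V`, the tip of the radius is reached by `V` from
one of the two sides. -/
theorem exists_side {e : ℂ} (he : ‖e‖ = 1) {l x : ℝ} (hl0 : 0 < l) (hl1 : l < 1) (hx0 : 0 < x)
    (hx : (x * e : ℂ) ∈ closure V) (hlx : ((l * x : ℝ) * e : ℂ) ∉ V) :
    ∃ s T : ℝ, s ≠ 0 ∧ (∀ x : ℝ, (x * e : ℂ) ∈ closure V → x ≤ T) ∧
      ∀ ρ > 0, ∃ v ∈ V ∩ ball (T * e : ℂ) ρ, 0 < dirSlope s e v := by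
  have hcont : Continuous fun x : ℝ => (x * e : ℂ) := by fun_prop
  have hcomp : IsCompact {x : ℝ | (x * e : ℂ) ∈ closure V} := by
    obtain ⟨R, hR⟩ := hV.isCompact_closure.isBounded.subset_closedBall (0 : ℂ)
    refine Metric.isCompact_of_isClosed_isBounded (isClosed_closure.preimage hcont)
      ((isBounded_closedBall (x := (0 : ℝ)) (r := R)).subset fun y hy => ?_)
    have : (y * e : ℂ) ∈ closedBall (0 : ℂ) R := hR hy
    simpa [he] using this
  obtain ⟨T, hT, hTmax⟩ := hcomp.exists_isGreatest ⟨x, hx⟩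
  have hTx : l * x < T := lt_of_lt_of_le (by nlinarith) (hTmax hx)
  have hlx0 : 0 < l * x := by positivity
  suffices h : (∀ ρ > 0, ∃ v ∈ V ∩ ball (T * e : ℂ) ρ, 0 < dirSlope 1 e v) ∨
      ∀ ρ > 0, ∃ v ∈ V ∩ ball (T * e : ℂ) ρ, 0 < dirSlope (-1) e v by
    rcases h with h | h
    · exact ⟨1, T, one_ne_zero, fun y hy => hTmax hy, h⟩
    · exact ⟨-1, T, by norm_num, fun y hy => hTmax hy, h⟩
  by_contra! hcon
  obtain ⟨⟨ρ₁, hρ₁, h1⟩, ρ₂, hρ₂, h2⟩ := hcon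
  have hev : ∀ᶠ v in 𝓝 (T * e : ℂ), l * x < dirRe e v ∧ v ∈ ball (T * e : ℂ) ρ₁ ∧
      v ∈ ball (T * e : ℂ) ρ₂ :=
    ((continuous_dirRe e).continuousAt.eventually_const_lt
      (by rwa [dirRe_ofReal_mul_self he])).and
      ((isOpen_ball.eventually_mem (mem_ball_self hρ₁)).and
        (isOpen_ball.eventually_mem (mem_ball_self hρ₂)))
  obtain ⟨v, hvV, hv, hv1, hv2⟩ := ((mem_closure_iff_frequently.1 hT).and_eventually hev).exists
  have h1 := h1 v ⟨hvV, hv1⟩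
  have h2 := h2 v ⟨hvV, hv2⟩
  have hneg : dirSlope (-1) e v = -dirSlope 1 e v := by unfold dirSlope; ring
  have h0 : dirSlope 1 e v = dirSlope 1 e ((l * x : ℝ) * e : ℂ) := by
    rw [dirSlope_ofReal_mul_self 1 he]; linarith
  have hre : dirRe e ((l * x : ℝ) * e : ℂ) = l * x := dirRe_ofReal_mul_self he _
  have := eq_ofReal_mul_of_dirSlope_eq one_ne_zero he (by rw [hre]; exact hlx0)
    (hlx0.trans hv) h0.symm
  rw [hre] at this
  apply hlx
  rw [this]
  have hv0 := hlx0.trans hv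
  exact hV.star v hvV _ ⟨by positivity, (div_le_one hv0).2 hv.le⟩

end IsStarJordan
end StarlikeJordan

noncomputable section StarlikeJordan
open Set Metric ComplexConjugate Filter Topology

theorem dirSlope_lt_dirSlope {s : ℝ} {e z w : ℂ} (he : ‖e‖ = 1) (hz : 0 < dirRe e z)
    (hw : 0 < dirRe e w) (h : 0 < s * (conj z * w).im) : dirSlope s e z < dirSlope s e w := by
  have hab : conj z * w = conj (conj e * z) * (conj e * w) := by
    have := conj_mul_self_of_norm_eq_one he
    rw [map_mul, Complex.conj_conj]
    linear_combination (-(conj z * w)) * this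
  rw [hab] at h
  unfold dirRe dirSlope at *
  rw [div_lt_div_iff₀ hz hw]
  rw [Complex.mul_im, Complex.conj_re, Complex.conj_im] at h
  linarith

namespace IsStarJordan

variable {V : Set ℂ} (hV : IsStarJordan V)
include hV

/-- The closure of a starlike Jordan domain is mapped into the domain by entire functions
arbitrarily close to the identity. -/
theorem exists_entire_mapsTo {ε : ℝ} (hε : 0 < ε) :
    ∃ φ : ℂ → ℂ, Differentiable ℂ φ ∧ MapsTo φ (closure V) V ∧
      ∀ z ∈ closure V, ‖φ z - z‖ < ε := by
  obtain ⟨R, hR0, hR⟩ := hV.isCompact_closure.isBounded.subset_closedBall_lt 0 (0 : ℂ)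
  obtain ⟨δ, hδ, hδV⟩ := Metric.isOpen_iff.1 hV.isOpen 0 hV.zero_mem
  obtain ⟨l, hl, hl1⟩ := exists_between (show max 0 (1 - ε / R) < 1 by
    rw [max_lt_iff]; exact ⟨one_pos, by linarith [div_pos hε hR0]⟩)
  obtain ⟨hl0, hlε⟩ := max_lt_iff.1 hl
  have hfin := hV.finite_bad_directions hl0 hl1
  set Θ := hfin.toFinset with hΘdef
  have hΘ : ∀ e ∈ Θ, ‖e‖ = 1 := fun e he => ((hfin.mem_toFinset).1 he).1
  have hside : ∀ e ∈ Θ, ∃ s T : ℝ, s ≠ 0 ∧ (∀ x : ℝ, (x * e : ℂ) ∈ closure V → x ≤ T) ∧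
      ∀ ρ > 0, ∃ v ∈ V ∩ ball (T * e : ℂ) ρ, 0 < dirSlope s e v := by
    intro e he
    obtain ⟨he1, x, hx0, hx, hlx⟩ := hfin.mem_toFinset.1 he
    exact hV.exists_side he1 hl0 hl1 hx0 hx hlx
  choose! s T hs hT hsT using hside
  obtain ⟨h, hh, hsign⟩ := exists_entire_re_sign Θ hΘ s hs (B := R) hδ
  have hhc := hh.continuous
  set Φ : ℝ → ℂ → ℂ := fun η z => l * z * Complex.exp (Complex.I * η * h z) with hΦ
  have hΦc : Continuous fun y : ℝ × ℂ => Φ y.1 y.2 := by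
    rw [hΦ]; dsimp only; fun_prop
  have hΦ0 : ∀ z, Φ 0 z = l * z := fun z => by simp [hΦ]
  have hmaps : ∀ᶠ η in 𝓝 (0 : ℝ), ∀ z ∈ closure V, 0 < η → z ∈ closure V → Φ η z ∈ V := by
    apply hV.isCompact_closure.eventually_forall_of_forall_eventually
    intro z hz
    by_cases hlz : (l : ℂ) * z ∈ V
    · have : ∀ᶠ y : ℝ × ℂ in 𝓝 (0, z), Φ y.1 y.2 ∈ V :=
        hΦc.continuousAt.eventually_mem (hV.isOpen.mem_nhds (by simpa [hΦ0] using hlz))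
      filter_upwards [this] with y hy _ _ using hy
    have hz0 : z ≠ 0 := by
      rintro rfl
      exact hlz (by simpa using hV.zero_mem)
    have hx0 : 0 < ‖z‖ := norm_pos_iff.2 hz0
    set e : ℂ := ((‖z‖⁻¹ : ℝ) : ℂ) * z with he'
    have he : ‖e‖ = 1 := by
      rw [he', norm_mul, Complex.norm_real, norm_inv, norm_norm, inv_mul_cancel₀ hx0.ne']
    have hze : (‖z‖ : ℂ) * e = z := by
      rw [he', ← mul_assoc, ← Complex.ofReal_mul, mul_inv_cancel₀ hx0.ne']; simp
    have hlze : ((l * ‖z‖ : ℝ) : ℂ) * e = l * z := by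
      rw [Complex.ofReal_mul, mul_assoc, hze]
    have heΘ : e ∈ Θ := hfin.mem_toFinset.2 ⟨he, ‖z‖, hx0, by rwa [hze], by rwa [hlze]⟩
    have hxδ : ‖z‖ ∈ Icc δ R := by
      refine ⟨?_, by simpa using hR hz⟩
      by_contra! hlt
      apply hlz
      apply hδV
      rw [mem_ball_zero_iff, norm_mul, Complex.norm_real, Real.norm_of_nonneg hl0.le]
      nlinarith
    obtain ⟨ρ, hρ, hpush⟩ := hV.exists_push he hl0 hl1 (hs e heΘ) (hT e heΘ) (hsT e heΘ) hx0
      (by rwa [hze])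
    rw [hze, hlze] at hpush
    have hsg := hsign e heΘ _ hxδ
    rw [hze] at hsg
    have hrez : 0 < dirRe e z := by
      rw [← hze, dirRe_ofReal_mul_self he]; exact hx0
    have hrelz : 0 < dirRe e (Φ 0 z) := by
      rw [hΦ0, dirRe_ofReal_mul]; positivity
    have e1 : ∀ᶠ y : ℝ × ℂ in 𝓝 (0, z), y.2 ∈ ball z ρ :=
      continuous_snd.continuousAt.eventually_mem (ball_mem_nhds _ hρ)
    have e2 : ∀ᶠ y : ℝ × ℂ in 𝓝 (0, z), Φ y.1 y.2 ∈ ball (l * z : ℂ) ρ :=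
      hΦc.continuousAt.eventually_mem (by simpa only [hΦ0] using ball_mem_nhds _ hρ)
    have e3 : ∀ᶠ y : ℝ × ℂ in 𝓝 (0, z), 0 < dirRe e y.2 :=
      ((continuous_dirRe e).comp continuous_snd).continuousAt.eventually_const_lt hrez
    have e4 : ∀ᶠ y : ℝ × ℂ in 𝓝 (0, z), 0 < dirRe e (Φ y.1 y.2) :=
      ((continuous_dirRe e).comp hΦc).continuousAt.eventually_const_lt hrelz
    have e5 : ∀ᶠ y : ℝ × ℂ in 𝓝 (0, z), 0 < s e * (h y.2).re := by
      have : Continuous fun y : ℝ × ℂ => s e * (h y.2).re := by fun_prop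
      exact this.continuousAt.eventually_const_lt hsg
    have e6 : ∀ᶠ y : ℝ × ℂ in 𝓝 (0, z), |y.1 * (h y.2).re| < Real.pi := by
      have : Continuous fun y : ℝ × ℂ => |y.1 * (h y.2).re| := by fun_prop
      exact this.continuousAt.eventually_lt_const (by simp [Real.pi_pos])
    filter_upwards [e1, e2, e3, e4, e5, e6] with ⟨η, z'⟩ h1 h2 h3 h4 h5 h6 hη hz'
    dsimp only at *
    refine hpush z' ⟨hz', h1⟩ _ h2 (dirSlope_lt_dirSlope he h3 h4 ?_)
    have hz'0 : 0 < Complex.normSq z' := by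
      rw [Complex.normSq_pos]
      rintro rfl
      simp [dirRe] at h3
    have heq : (conj z' * Φ η z').im =
        l * Complex.normSq z' * (Real.exp (-(η * (h z').im)) * Real.sin (η * (h z').re)) := by
      have : conj z' * Φ η z' = ((l * Complex.normSq z' : ℝ) : ℂ) *
          Complex.exp (Complex.I * η * h z') := by
        rw [Complex.ofReal_mul, Complex.normSq_eq_conj_mul_self]
        simp only [hΦ]; ring
      rw [this, Complex.im_ofReal_mul, Complex.exp_im]
      congr 3 <;> simp
    have hsin : 0 < s e * Real.sin (η * (h z').re) := by
      obtain ⟨h6a, h6b⟩ := abs_lt.1 h6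
      rcases lt_or_gt_of_ne (hs e heΘ) with hs0 | hs0
      · have : (h z').re < 0 := by
          by_contra! hcon
          nlinarith
        exact mul_pos_of_neg_of_neg hs0
          (Real.sin_neg_of_neg_of_neg_pi_lt (mul_neg_of_pos_of_neg hη this) h6a)
      · have : 0 < (h z').re := pos_of_mul_pos_right h5 hs0.le
        exact mul_pos hs0 (Real.sin_pos_of_pos_of_lt_pi (mul_pos hη this) h6b)
    rw [heq]
    have : 0 < l * Complex.normSq z' * Real.exp (-(η * (h z').im)) := by positivity
    nlinarith [mul_pos this hsin]
  have hclose : ∀ᶠ η in 𝓝 (0 : ℝ), ∀ z ∈ closure V, ‖Φ η z - z‖ < ε := by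
    apply hV.isCompact_closure.eventually_forall_of_forall_eventually
    intro z hz
    have : Continuous fun y : ℝ × ℂ => ‖Φ y.1 y.2 - y.2‖ := by fun_prop
    refine this.continuousAt.eventually_lt_const ?_
    dsimp only
    have hzR : ‖z‖ ≤ R := by simpa using hR hz
    have : (l : ℂ) * z - z = -((1 - l : ℝ) : ℂ) * z := by push_cast; ring
    rw [hΦ0, this, norm_mul, norm_neg, Complex.norm_real, Real.norm_of_nonneg (by linarith)]
    calc (1 - l) * ‖z‖ ≤ (1 - l) * R := by gcongr
      _ < ε / R * R := by gcongr; linarith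
      _ = ε := div_mul_cancel₀ _ hR0.ne'
  obtain ⟨η, ⟨h1, h2⟩, hη⟩ :=
    (((hmaps.and hclose).filter_mono nhdsWithin_le_nhds).and
      (self_mem_nhdsWithin : Ioi (0 : ℝ) ∈ 𝓝[>] 0)).exists
  refine ⟨Φ η, ?_, fun z hz => h1 z hz hη hz, h2⟩
  rw [hΦ]; dsimp only
  fun_prop

end IsStarJordan

/-- **Polynomial approximation on starlike Jordan domains.** -/
theorem IsStarJordan.polyApprox {E : Type*} [NormedAddCommGroup E] [NormedSpace ℂ E]
    [CompleteSpace E] {V : Set ℂ} {p : ℂ} (hV : IsStarJordan ((fun z => z + p) ⁻¹' V)) {G : ℂ → E}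
    (hG : DifferentiableOn ℂ G V) (hGc : ContinuousOn G (closure V)) :
    PolyApprox (closure V) G := by
  set τ : ℂ ≃ₜ ℂ := Homeomorph.addRight p with hτ
  have hcl : closure ((fun z => z + p) ⁻¹' V) = (fun z => z + p) ⁻¹' closure V :=
    (τ.preimage_closure V).symm
  have hmem : ∀ z ∈ closure V, z - p ∈ closure ((fun z => z + p) ⁻¹' V) := fun z hz => by
    rw [hcl]; simpa using hz
  have hVo : IsOpen V := (τ.isOpen_preimage).1 hV.isOpen
  have hDc : IsCompact (closure V) := (τ.isCompact_preimage).1 (by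
    have := hV.isCompact_closure
    rwa [hcl] at this)
  refine PolyApprox.of_forall fun ε hε => ?_
  obtain ⟨δ, hδ, hu⟩ := Metric.uniformContinuousOn_iff.1 (hDc.uniformContinuousOn_of_continuous hGc)
    ε hε
  obtain ⟨φ, hφ, hφV, hφδ⟩ := hV.exists_entire_mapsTo hδ
  set ψ : ℂ → ℂ := fun z => φ (z - p) + p with hψ
  have hψd : Differentiable ℂ ψ := by rw [hψ]; fun_prop
  have hψV : MapsTo ψ (closure V) V := fun z hz => hφV (hmem z hz)
  refine ⟨fun z => G (ψ z), ?_, fun z hz => ?_⟩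
  · refine polyApprox_of_differentiableOn hDc (p := p) (fun z hz t ht => ?_)
      (hVo.preimage hψd.continuous) hψV
      (hG.comp hψd.differentiableOn fun z hz => hz)
    have := hV.closure_star (hmem z hz) ht
    rw [hcl, mem_preimage] at this
    rwa [Complex.real_smul, add_comm]
  · rw [← dist_eq_norm]
    refine hu z hz (ψ z) (subset_closure (hψV hz)) ?_
    rw [dist_comm, dist_eq_norm]
    have := hφδ _ (hmem z hz)
    rwa [show ψ z - z = φ (z - p) - (z - p) by rw [hψ]; ring]
end StarlikeJordan

noncomputable section SliceAnalysis
open Set Metric ComplexConjugate Filter Topology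
open scoped Quaternion

/-- The sphere of unit imaginary quaternions. -/
abbrev UnitImag : Type := {J : ℍ[ℝ] // J ^ 2 = -1}

namespace UnitImag

theorem mul_self (K : UnitImag) : (K : ℍ[ℝ]) * K = -1 := by rw [← sq, K.2]

theorem re_and_normSq (K : UnitImag) : (K : ℍ[ℝ]).re = 0 ∧ Quaternion.normSq (K : ℍ[ℝ]) = 1 := by
  have hN : Quaternion.normSq (K : ℍ[ℝ]) = 1 := by
    have h := congrArg Quaternion.normSq K.2
    rw [map_pow, Quaternion.normSq_neg, map_one] at h
    exact (pow_eq_one_iff_of_nonneg Quaternion.normSq_nonneg two_ne_zero).1 h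
  refine ⟨Quaternion.sq_eq_neg_normSq.1 ?_, hN⟩
  rw [hN, K.2, Quaternion.coe_one]

instance : Neg UnitImag := ⟨fun K => ⟨-K, by rw [neg_sq, K.2]⟩⟩

theorem coe_neg (K : UnitImag) : ((-K : UnitImag) : ℍ[ℝ]) = -K := rfl

instance : Nonempty UnitImag := by
  have h : ∃ J : ℍ[ℝ], J.re = 0 ∧ Quaternion.normSq J = 1 :=
    ⟨⟨0, 1, 0, 0⟩, rfl, (Quaternion.normSq_def' _).trans (by simp)⟩
  obtain ⟨J, h1, h2⟩ := h
  exact ⟨J, by rw [Quaternion.sq_eq_neg_normSq.2 h1, h2, Quaternion.coe_one]⟩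

instance : CompleteSpace UnitImag :=
  (isClosed_eq (by fun_prop) continuous_const : IsClosed {J : ℍ[ℝ] | J ^ 2 = -1}).completeSpace_coe

/-- The identification of `ℂ` with the slice plane of `K`. -/
def emb (K : UnitImag) : ℂ →ₐ[ℝ] ℍ[ℝ] := Complex.liftAux K K.mul_self

theorem emb_apply (K : UnitImag) (z : ℂ) : K.emb z = (z.re : ℍ[ℝ]) + z.im • (K : ℍ[ℝ]) := rfl

theorem emb_ofReal (K : UnitImag) (x : ℝ) : K.emb x = (x : ℍ[ℝ]) := by simp

theorem emb_conj (K : UnitImag) (z : ℂ) : K.emb (conj z) = (-K).emb z := by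
  simp [emb_apply, coe_neg]

theorem norm_emb (K : UnitImag) (z : ℂ) : ‖K.emb z‖ = ‖z‖ := by
  obtain ⟨h1, h2⟩ := K.re_and_normSq
  rw [← sq_eq_sq₀ (norm_nonneg _) (norm_nonneg _), sq, ← Quaternion.normSq_eq_norm_mul_self,
    Complex.sq_norm, Complex.normSq_apply, emb_apply]
  rw [Quaternion.normSq_def', h1] at h2
  rw [Quaternion.normSq_def']
  simp [h1]
  linear_combination (z.im ^ 2) * h2

theorem isometry_emb (K : UnitImag) : Isometry K.emb :=
  AddMonoidHomClass.isometry_of_norm _ K.norm_emb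

theorem mem_slicePlane_emb (K : UnitImag) (z : ℂ) : K.emb z ∈ slicePlane K := ⟨z.re, z.im, rfl⟩

/-- The identification of `ℂ` with the slice plane of `K`, as a homeomorphism. -/
def homeo (K : UnitImag) : ℂ ≃ₜ slicePlane (K : ℍ[ℝ]) :=
  (IsometryEquiv.mk (Equiv.ofBijective (fun z => ⟨K.emb z, K.mem_slicePlane_emb z⟩)
    ⟨fun _ _ h => K.isometry_emb.injective (congrArg Subtype.val h), by
      rintro ⟨_, x, y, rfl⟩
      exact ⟨⟨x, y⟩, rfl⟩⟩) fun x y => K.isometry_emb x y).toHomeomorph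

theorem coe_homeo (K : UnitImag) (z : ℂ) : (K.homeo z : ℍ[ℝ]) = K.emb z := rfl

/-- A nonreal quaternion lies on the slice of either sign of its normalized imaginary part. -/
theorem exists_emb_eq (q : ℍ[ℝ]) {σ : ℝ} (hσ : σ ^ 2 = 1) (hq : q.im ≠ 0) :
    ∃ K : UnitImag, (K : ℍ[ℝ]) = (σ * ‖q.im‖⁻¹) • q.im ∧ K.emb ⟨q.re, σ * ‖q.im‖⟩ = q := by
  have hn : ‖q.im‖ ≠ 0 := norm_ne_zero_iff.2 hq
  have hsq : q.im * q.im = ((-(‖q.im‖ * ‖q.im‖) : ℝ) : ℍ[ℝ]) := by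
    rw [← Quaternion.normSq_eq_norm_mul_self, ← sq, Quaternion.im_sq, Quaternion.coe_neg]
  refine ⟨⟨(σ * ‖q.im‖⁻¹) • q.im, ?_⟩, rfl, ?_⟩
  · rw [sq, smul_mul_smul_comm, hsq, ← Quaternion.coe_smul, smul_eq_mul,
      show σ * ‖q.im‖⁻¹ * (σ * ‖q.im‖⁻¹) * -(‖q.im‖ * ‖q.im‖) =
        -(σ ^ 2) * (‖q.im‖⁻¹ * ‖q.im‖) ^ 2 by ring, hσ, inv_mul_cancel₀ hn]
    simp
  · rw [emb_apply]
    dsimp only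
    rw [smul_smul, show σ * ‖q.im‖ * (σ * ‖q.im‖⁻¹) = σ ^ 2 * (‖q.im‖⁻¹ * ‖q.im‖) by ring, hσ,
      inv_mul_cancel₀ hn, mul_one, one_smul, Quaternion.re_add_im]

theorem exists_emb (q : ℍ[ℝ]) : ∃ (K : UnitImag) (z : ℂ), K.emb z = q := by
  by_cases hq : q.im = 0
  · refine ⟨Classical.arbitrary _, q.re, ?_⟩
    rw [emb_ofReal]
    conv_rhs => rw [← Quaternion.re_add_im q, hq, add_zero]
  · obtain ⟨K, -, hK⟩ := exists_emb_eq q (one_pow 2) hq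
    exact ⟨K, _, hK⟩

end UnitImag

/-- The quaternions as a complex vector space, `Complex.I` acting as left multiplication by the
unit imaginary quaternion `K`. -/
def SliceSpace (_ : UnitImag) : Type := ℍ[ℝ]

namespace SliceSpace

variable (K : UnitImag)

instance : NormedAddCommGroup (SliceSpace K) := inferInstanceAs (NormedAddCommGroup ℍ[ℝ])

instance : CompleteSpace (SliceSpace K) := inferInstanceAs (CompleteSpace ℍ[ℝ])

instance : NormedSpace ℂ (SliceSpace K) where
  smul z q := (K.emb z * (show ℍ[ℝ] from q) : ℍ[ℝ])
  one_smul q := show K.emb 1 * (show ℍ[ℝ] from q) = q by rw [map_one, one_mul]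
  mul_smul z w q := show K.emb (z * w) * (show ℍ[ℝ] from q) =
    K.emb z * (K.emb w * (show ℍ[ℝ] from q)) by
    rw [map_mul, mul_assoc]
  smul_zero z := mul_zero (K.emb z)
  smul_add z := mul_add (K.emb z)
  add_smul z w q := show K.emb (z + w) * (show ℍ[ℝ] from q) =
    K.emb z * (show ℍ[ℝ] from q) + K.emb w * (show ℍ[ℝ] from q) by
    rw [map_add, add_mul]
  zero_smul q := show K.emb 0 * (show ℍ[ℝ] from q) = 0 by rw [map_zero, zero_mul]
  norm_smul_le z q := show ‖K.emb z * (show ℍ[ℝ] from q)‖ ≤ ‖z‖ * ‖(show ℍ[ℝ] from q)‖ by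
    rw [norm_mul, K.norm_emb]

variable {K}

/-- A function on `ℂ` regarded as a function into the complex vector space `SliceSpace K`. -/
def lift (K : UnitImag) (F : ℂ → ℍ[ℝ]) : ℂ → SliceSpace K := F

/-- The Cauchy-Riemann equation for the slice structure. -/
theorem hasDerivAt_lift {F : ℂ → ℍ[ℝ]} {L : ℂ →L[ℝ] ℍ[ℝ]} {z : ℂ} (hF : HasFDerivAt F L z)
    {a : ℍ[ℝ]} (hL : ∀ w, L w = K.emb w * a) :
    HasDerivAt (lift K F) (show SliceSpace K from a) z := by
  rw [hasDerivAt_iff_isLittleO]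
  have h := hF.isLittleO
  simp only [hL] at h
  exact h

end SliceSpace
end SliceAnalysis

noncomputable section SliceAnalysis
open Set Metric ComplexConjugate Filter Topology
open scoped Quaternion

namespace SliceRegularOn

/-- Slice regular functions are complex differentiable along every slice. -/
theorem exists_hasFDerivAt_emb {f : ℍ[ℝ] → ℍ[ℝ]} {S : Set ℍ[ℝ]} (hf : SliceRegularOn f S)
    (hS : IsOpen S) (K : UnitImag) {z : ℂ} (hz : K.emb z ∈ S) :
    ∃ (L : ℂ →L[ℝ] ℍ[ℝ]) (a : ℍ[ℝ]), HasFDerivAt (fun w => f (K.emb w)) L z ∧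
      ∀ w, L w = K.emb w * a := by
  have hA := ((hf.1 _ hz).differentiableAt (hS.mem_nhds hz)).hasFDerivAt
  set A := fderiv ℝ f (K.emb z) with hAdef
  have hι : HasFDerivAt (fun w => K.emb w) (LinearMap.toContinuousLinearMap K.emb.toLinearMap) z :=
    (LinearMap.toContinuousLinearMap K.emb.toLinearMap).hasFDerivAt
  have hprod : HasFDerivAt (fun y : ℝ × ℝ => f ((y.1 : ℍ[ℝ]) + y.2 • (K : ℍ[ℝ])))
      ((A.comp (LinearMap.toContinuousLinearMap K.emb.toLinearMap)).comp
        (Complex.equivRealProdCLM.symm : ℝ × ℝ →L[ℝ] ℂ)) (z.re, z.im) := by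
    refine HasFDerivAt.comp (z.re, z.im) (f := Complex.equivRealProdCLM.symm)
      (g := fun w => f (K.emb w)) ?_ Complex.equivRealProdCLM.symm.hasFDerivAt
    exact hA.comp z hι
  have hCR := hf.2 K K.2 z.re z.im hz
  rw [hprod.fderiv] at hCR
  have h1 : K.emb (Complex.equivRealProdCLM.symm (1, 0)) = 1 := by
    simp [UnitImag.emb_apply]
  have h2 : K.emb (Complex.equivRealProdCLM.symm (0, 1)) = K := by
    simp [UnitImag.emb_apply]
  change A (K.emb (Complex.equivRealProdCLM.symm (1, 0))) +
    K * A (K.emb (Complex.equivRealProdCLM.symm (0, 1))) = 0 at hCR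
  rw [h1, h2] at hCR
  have hAK : A K = K * A 1 := by
    rw [eq_neg_of_add_eq_zero_left hCR, mul_neg, ← mul_assoc, K.mul_self]
    simp
  refine ⟨_, A 1, hA.comp z hι, fun w => ?_⟩
  change A (K.emb w) = _
  have : K.emb w = w.re • (1 : ℍ[ℝ]) + w.im • (K : ℍ[ℝ]) := by
    rw [UnitImag.emb_apply]
    congr 1
    exact Algebra.algebraMap_eq_smul_one w.re
  rw [this, map_add, map_smul, map_smul, hAK, add_mul, smul_mul_assoc, smul_mul_assoc, one_mul]

end SliceRegularOn

/-- An open starlike set with Jordan slices, whose closure is axially symmetric. -/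
structure IsStarJordanBody (S : Set ℍ[ℝ]) (p : ℝ) : Prop where
  isOpen : IsOpen S
  isBounded : Bornology.IsBounded S
  jordan : ∀ I : ℍ[ℝ], I ^ 2 = -1 → IsJordanRegionIn I (S ∩ slicePlane I)
  mem : (p : ℍ[ℝ]) ∈ S
  star : ∀ q ∈ S, ∀ t : ℝ, t ∈ Icc (0 : ℝ) 1 → (p : ℍ[ℝ]) + t • (q - (p : ℍ[ℝ])) ∈ S
  axial : AxiallySymmetric (closure S)

namespace IsStarJordanBody

variable {S : Set ℍ[ℝ]} {p : ℝ} (hS : IsStarJordanBody S p)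
include hS

theorem isOpen_slice (K : UnitImag) : IsOpen (K.emb ⁻¹' S) :=
  hS.isOpen.preimage K.isometry_emb.continuous

theorem star_slice (K : UnitImag) {z : ℂ} (hz : K.emb z ∈ S) {t : ℝ} (ht : t ∈ Icc (0 : ℝ) 1) :
    K.emb (p + t • (z - p)) ∈ S := by
  have := hS.star _ hz t ht
  rwa [← K.emb_ofReal, ← map_sub, ← map_smul, ← map_add] at this

theorem isStarJordan_slice (K : UnitImag) :
    IsStarJordan ((fun z => z + (p : ℂ)) ⁻¹' (K.emb ⁻¹' S)) where
  isOpen := (hS.isOpen_slice K).preimage (by fun_prop)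
  isBounded := by
    obtain ⟨R, hR⟩ := hS.isBounded.subset_closedBall (p : ℍ[ℝ])
    refine (isBounded_closedBall (x := (0 : ℂ)) (r := R)).subset fun z hz => ?_
    have := hR hz
    rw [← K.emb_ofReal, mem_closedBall, K.isometry_emb.dist_eq] at this
    simpa using this
  zero_mem := by
    simpa [K.emb_ofReal] using hS.mem
  star z hz t ht := by
    have := hS.star_slice K hz ht
    rw [add_sub_cancel_right, Complex.real_smul, add_comm] at this
    exact this
  jordan := by
    obtain ⟨-, -, -, γ, hγ, hγi, hγr⟩ := hS.jordan K K.2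
    have hpre : K.homeo ⁻¹' (Subtype.val ⁻¹' (S ∩ slicePlane (K : ℍ[ℝ]))) = K.emb ⁻¹' S := by
      ext z
      simp [K.coe_homeo]
    set e : ℂ ≃ₜ slicePlane (K : ℍ[ℝ]) := (Homeomorph.addRight (p : ℂ)).trans K.homeo with he
    have hpre' : e ⁻¹' (Subtype.val ⁻¹' (S ∩ slicePlane (K : ℍ[ℝ]))) =
        (fun z => z + (p : ℂ)) ⁻¹' (K.emb ⁻¹' S) := by
      rw [← hpre]; rfl
    refine ⟨e.symm ∘ γ, e.symm.continuous.comp hγ, e.symm.injective.comp hγi, ?_⟩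
    rw [range_comp, hγr, ← hpre', ← e.preimage_frontier, e.symm.image_eq_preimage_symm,
      Homeomorph.symm_symm]

/-- The slices of `closure S` do not depend on the imaginary unit. -/
theorem emb_mem_closure_iff (J K : UnitImag) {z : ℂ} :
    J.emb z ∈ closure S ↔ K.emb z ∈ closure S :=
  ⟨hS.axial z.re z.im J K J.2 K.2, hS.axial z.re z.im K J K.2 J.2⟩

theorem emb_conj_mem_closure (K : UnitImag) {z : ℂ} (hz : K.emb z ∈ closure S) :
    K.emb (conj z) ∈ closure S := by
  rw [K.emb_conj]
  exact (hS.emb_mem_closure_iff K (-K)).1 hz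

/-- The open slices are nowhere missing from the closed slice. -/
theorem exists_emb_mem_of_isOpen (J : UnitImag) {B : Set ℂ} (hB : IsOpen B) {z : ℂ} (hz : z ∈ B)
    (hzS : J.emb z ∈ closure S) {U : Set UnitImag} (hU : IsOpen U) (hJ : J ∈ U) :
    ∃ K ∈ U, ∃ w ∈ B, K.emb w ∈ S := by
  have hparam : ∀ σ : ℝ, Continuous fun q : ℍ[ℝ] => (⟨q.re, σ * ‖q.im‖⟩ : ℂ) := fun σ => by
    have h : (fun q : ℍ[ℝ] => (⟨q.re, σ * ‖q.im‖⟩ : ℂ)) =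
        fun q => (q.re : ℂ) + (σ * ‖q.im‖ : ℝ) * Complex.I := by
      ext q
      exact Complex.mk_eq_add_mul_I _ _
    rw [h]
    have := Quaternion.continuous_re
    have := Quaternion.continuous_im
    fun_prop
  have nonreal : ∀ w ∈ B, w.im ≠ 0 → J.emb w ∈ closure S → ∃ K ∈ U, ∃ w ∈ B, K.emb w ∈ S := by
    intro w hw hw0 hwS
    obtain ⟨U', hU', rfl⟩ := isOpen_induced_iff.1 hU
    obtain ⟨hJre, hJn⟩ := J.re_and_normSq
    have hJ1 : ‖(J : ℍ[ℝ])‖ = 1 := by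
      rw [Quaternion.normSq_eq_norm_mul_self, ← sq] at hJn
      exact (pow_eq_one_iff_of_nonneg (norm_nonneg _) two_ne_zero).1 hJn
    set σ : ℝ := w.im / |w.im| with hσdef
    have habs : |w.im| ≠ 0 := abs_ne_zero.2 hw0
    have hσ : σ ^ 2 = 1 := by
      rw [hσdef, div_pow, sq_abs, div_self (pow_ne_zero 2 hw0)]
    have him : (J.emb w).im = w.im • (J : ℍ[ℝ]) := by
      ext <;> simp [UnitImag.emb_apply, hJre]
    have hnorm : ‖(J.emb w).im‖ = |w.im| := by
      rw [him, norm_smul, hJ1, mul_one, Real.norm_eq_abs]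
    have hne : (J.emb w).im ≠ 0 := norm_ne_zero_iff.1 (by rwa [hnorm])
    have himc := Quaternion.continuous_im
    have e1 : ∀ᶠ q in 𝓝 (J.emb w), q.im ≠ 0 := himc.continuousAt.eventually_ne hne
    have e2 : ∀ᶠ q in 𝓝 (J.emb w), (⟨q.re, σ * ‖q.im‖⟩ : ℂ) ∈ B := by
      refine (hparam σ).continuousAt.eventually_mem (hB.mem_nhds ?_)
      have : (⟨(J.emb w).re, σ * ‖(J.emb w).im‖⟩ : ℂ) = w := by
        rw [hnorm, div_mul_cancel₀ _ habs]
        apply Complex.ext <;> simp [UnitImag.emb_apply, hJre]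
      rwa [this]
    have e3 : ∀ᶠ q in 𝓝 (J.emb w), (σ * ‖q.im‖⁻¹) • q.im ∈ U' := by
      have hc : ContinuousAt (fun q : ℍ[ℝ] => (σ * ‖q.im‖⁻¹) • q.im) (J.emb w) :=
        (continuousAt_const.mul (himc.norm.continuousAt.inv₀ (norm_ne_zero_iff.2 hne))).smul
          himc.continuousAt
      refine hc.eventually_mem (hU'.mem_nhds ?_)
      have : (σ * ‖(J.emb w).im‖⁻¹) • (J.emb w).im = J := by
        rw [hnorm, him, smul_smul, show σ * |w.im|⁻¹ * w.im = σ ^ 2 by rw [hσdef]; ring, hσ,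
          one_smul]
      rwa [this]
    obtain ⟨q, hqS, h1, h2, h3⟩ :=
      ((mem_closure_iff_frequently.1 hwS).and_eventually (e1.and (e2.and e3))).exists
    obtain ⟨K, hK, hKq⟩ := UnitImag.exists_emb_eq q hσ h1
    refine ⟨K, ?_, _, h2, by rwa [hKq]⟩
    rw [mem_preimage, hK]
    exact h3
  by_cases hz0 : z.im = 0
  · have e : ∀ᶠ q in 𝓝 (J.emb z), (⟨q.re, 1 * ‖q.im‖⟩ : ℂ) ∈ B := by
      refine (hparam 1).continuousAt.eventually_mem (hB.mem_nhds ?_)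
      have : (⟨(J.emb z).re, 1 * ‖(J.emb z).im‖⟩ : ℂ) = z := by
        apply Complex.ext <;> simp [UnitImag.emb_apply, hz0]
      rwa [this]
    obtain ⟨q, hqS, hqB⟩ := ((mem_closure_iff_frequently.1 hzS).and_eventually e).exists
    by_cases hq : q.im = 0
    · have hline : Continuous fun t : ℝ => (⟨q.re, t⟩ : ℂ) := by
        simp only [Complex.mk_eq_add_mul_I]
        fun_prop
      have e1 : ∀ᶠ t in 𝓝 (0 : ℝ), (⟨q.re, t⟩ : ℂ) ∈ B :=
        hline.continuousAt.eventually_mem (hB.mem_nhds (by simpa [hq] using hqB))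
      have e2 : ∀ᶠ t in 𝓝 (0 : ℝ), J.emb ⟨q.re, t⟩ ∈ S := by
        refine (J.isometry_emb.continuous.comp hline).continuousAt.eventually_mem
          (hS.isOpen.mem_nhds ?_)
        have : J.emb ⟨q.re, 0⟩ = q := by
          conv_rhs => rw [← Quaternion.re_add_im q, hq]
          simp [UnitImag.emb_apply]
        rwa [Function.comp_apply, this]
      obtain ⟨t, ⟨h1, h2⟩, ht⟩ := (((e1.and e2).filter_mono nhdsWithin_le_nhds).and
        (self_mem_nhdsWithin : {(0 : ℝ)}ᶜ ∈ 𝓝[≠] 0)).exists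
      exact nonreal _ h1 ht (subset_closure h2)
    · obtain ⟨K, -, hK⟩ := UnitImag.exists_emb_eq q (one_pow 2) hq
      refine nonreal _ hqB ?_ ((hS.emb_mem_closure_iff K J).1 (by rw [hK]; exact subset_closure hqS))
      simpa using hq
  · exact nonreal z hz hz0 hzS

/-- For some imaginary unit, the open slice is dense in the closed one. -/
theorem exists_closure_slice : ∃ I : UnitImag, ∀ z, I.emb z ∈ closure S →
    z ∈ closure (I.emb ⁻¹' S) := by
  set J₀ : UnitImag := Classical.arbitrary _
  set b := {B ∈ TopologicalSpace.countableBasis ℂ | ∃ z ∈ B, J₀.emb z ∈ closure S} with hb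
  have hbc : b.Countable := (TopologicalSpace.countable_countableBasis ℂ).mono (sep_subset _ _)
  have hdense : Dense (⋂ B ∈ b, {J : UnitImag | ∃ w ∈ B, J.emb w ∈ S}) := by
    refine dense_biInter_of_isOpen (fun B _ => ?_) hbc fun B hB => ?_
    · have : {J : UnitImag | ∃ w ∈ B, J.emb w ∈ S} = ⋃ w ∈ B, {J | J.emb w ∈ S} := by
        ext; simp
      rw [this]
      refine isOpen_biUnion fun w _ => hS.isOpen.preimage ?_
      unfold UnitImag.emb
      simp only [Complex.liftAux_apply]
      fun_prop
    · rw [dense_iff_inter_open]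
      rintro U hU ⟨J, hJ⟩
      obtain ⟨hB1, z, hz, hzS⟩ := hB
      obtain ⟨K, hK, h⟩ := hS.exists_emb_mem_of_isOpen J
        (TopologicalSpace.isOpen_of_mem_countableBasis hB1) hz
        ((hS.emb_mem_closure_iff J₀ J).1 hzS) hU hJ
      exact ⟨K, hK, h⟩
  obtain ⟨I, hI⟩ := hdense.nonempty
  refine ⟨I, fun z hz => ?_⟩
  rw [(TopologicalSpace.isBasis_countableBasis ℂ).mem_closure_iff]
  intro B hB hzB
  obtain ⟨w, hw, hwS⟩ := mem_iInter₂.1 hI B ⟨hB, z, hzB, (hS.emb_mem_closure_iff I J₀).1 hz⟩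
  exact ⟨w, hw, hwS⟩

end IsStarJordanBody
end SliceAnalysis

noncomputable section SliceAnalysis
open Set Metric ComplexConjugate Filter Topology
open scoped Quaternion

namespace UnitImag

variable (I K : UnitImag)

/-- The value on the slice of `K` that the representation formula assigns to the values `a`, `b` at
two conjugate points of the slice of `I`. -/
def rep (a b : ℍ[ℝ]) : ℍ[ℝ] := (1 / 2 : ℝ) • ((1 - K * I) * a + (1 + K * I) * b)

theorem rep_self (a : ℍ[ℝ]) : rep I K a a = a := by
  rw [rep, ← add_mul, sub_add_add_cancel, one_add_one_eq_two, two_mul, ← two_smul ℝ, smul_smul]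
  simp

theorem rep_sub (a b c d : ℍ[ℝ]) : rep I K (a - c) (b - d) = rep I K a b - rep I K c d := by
  simp only [rep, mul_sub, ← smul_sub]
  congr 1
  abel

theorem rep_mul (a b c : ℍ[ℝ]) : rep I K (a * c) (b * c) = rep I K a b * c := by
  simp only [rep, smul_mul_assoc, add_mul, mul_assoc]

theorem rep_sum {ι : Type*} (s : Finset ι) (a b : ι → ℍ[ℝ]) :
    rep I K (∑ i ∈ s, a i) (∑ i ∈ s, b i) = ∑ i ∈ s, rep I K (a i) (b i) := by
  simp only [rep, Finset.mul_sum, ← Finset.sum_add_distrib, Finset.smul_sum]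

theorem norm_eq_one : ‖(K : ℍ[ℝ])‖ = 1 := by
  have h := K.re_and_normSq.2
  rw [Quaternion.normSq_eq_norm_mul_self, ← sq] at h
  exact (pow_eq_one_iff_of_nonneg (norm_nonneg _) two_ne_zero).1 h

theorem norm_rep_le (a b : ℍ[ℝ]) : ‖rep I K a b‖ ≤ ‖a‖ + ‖b‖ := by
  have h : ‖(K : ℍ[ℝ]) * I‖ = 1 := by rw [norm_mul, norm_eq_one, norm_eq_one, mul_one]
  have h1 : ‖1 - (K : ℍ[ℝ]) * I‖ ≤ 2 := (norm_sub_le _ _).trans (by rw [h, norm_one]; norm_num)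
  have h2 : ‖1 + (K : ℍ[ℝ]) * I‖ ≤ 2 := (norm_add_le _ _).trans (by rw [h, norm_one]; norm_num)
  rw [rep, norm_smul, Real.norm_of_nonneg (by norm_num)]
  have := norm_add_le ((1 - (K : ℍ[ℝ]) * I) * a) ((1 + (K : ℍ[ℝ]) * I) * b)
  rw [norm_mul, norm_mul] at this
  nlinarith [norm_nonneg a, norm_nonneg b]

theorem one_sub_mul_emb (w : ℂ) :
    (1 - (K : ℍ[ℝ]) * I) * I.emb w = K.emb w * (1 - (K : ℍ[ℝ]) * I) := by
  have h1 : (1 - (K : ℍ[ℝ]) * I) * I = K * (1 - (K : ℍ[ℝ]) * I) := by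
    rw [sub_mul, mul_sub, mul_assoc, I.mul_self, ← mul_assoc, K.mul_self]
    simp [add_comm]
  rw [emb_apply, emb_apply, mul_add, add_mul, mul_smul_comm, smul_mul_assoc, h1,
    Quaternion.coe_commutes]

theorem one_add_mul_emb_conj (w : ℂ) :
    (1 + (K : ℍ[ℝ]) * I) * I.emb (conj w) = K.emb w * (1 + (K : ℍ[ℝ]) * I) := by
  have := one_sub_mul_emb (-I) K w
  rwa [coe_neg, mul_neg, sub_neg_eq_add, ← emb_conj] at this

theorem rep_emb (w : ℂ) : rep I K (I.emb w) (I.emb (conj w)) = K.emb w := by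
  rw [rep, one_sub_mul_emb, one_add_mul_emb_conj, ← mul_add, sub_add_add_cancel, one_add_one_eq_two,
    mul_two, ← two_smul ℝ, smul_smul]
  simp

end UnitImag

open UnitImag

/-- **The representation formula** on the common part of the slices of a starlike body. -/
theorem IsStarJordanBody.rep_eq {S : Set ℍ[ℝ]} {p : ℝ} (hS : IsStarJordanBody S p)
    {f : ℍ[ℝ] → ℍ[ℝ]} (hf : SliceRegularOn f S) (I K : UnitImag) {z : ℂ} (hK : K.emb z ∈ S)
    (hI : I.emb z ∈ S) (hIc : I.emb (conj z) ∈ S) :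
    f (K.emb z) = rep I K (f (I.emb z)) (f (I.emb (conj z))) := by
  set T : Set ℂ := K.emb ⁻¹' S ∩ (I.emb ⁻¹' S ∩ conj ⁻¹' (I.emb ⁻¹' S)) with hT
  have hTo : IsOpen T := (hS.isOpen_slice K).inter ((hS.isOpen_slice I).inter
    ((hS.isOpen_slice I).preimage Complex.continuous_conj))
  have hpT : (p : ℂ) ∈ T := by
    simp only [hT, mem_inter_iff, mem_preimage, Complex.conj_ofReal, emb_ofReal]
    exact ⟨hS.mem, hS.mem, hS.mem⟩
  have hTstar : StarConvex ℝ (p : ℂ) T := by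
    rw [starConvex_iff_forall_pos hpT]
    intro w hw a b ha hb hab
    have ht : b ∈ Icc (0 : ℝ) 1 := ⟨hb.le, by linarith⟩
    have heq : a • (p : ℂ) + b • w = p + b • (w - p) := by
      rw [← eq_sub_iff_add_eq] at hab
      rw [hab]; module
    rw [heq]
    refine ⟨hS.star_slice K hw.1 ht, hS.star_slice I hw.2.1 ht, ?_⟩
    have := hS.star_slice I hw.2.2 ht
    simpa using this
  set g : ℂ → ℍ[ℝ] := fun w =>
    f (K.emb w) - rep I K (f (I.emb w)) (f (I.emb (conj w))) with hg
  have hdiff : DifferentiableOn ℂ (SliceSpace.lift K g) T := by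
    intro w hw
    obtain ⟨L₀, a₀, h₀, hL₀⟩ := hf.exists_hasFDerivAt_emb hS.isOpen K hw.1
    obtain ⟨L₁, a₁, h₁, hL₁⟩ := hf.exists_hasFDerivAt_emb hS.isOpen I hw.2.1
    obtain ⟨L₂, a₂, h₂, hL₂⟩ := hf.exists_hasFDerivAt_emb hS.isOpen I hw.2.2
    have h₂' : HasFDerivAt (fun w => f (I.emb (conj w)))
        (L₂.comp (Complex.conjCLE : ℂ →L[ℝ] ℂ)) w :=
      HasFDerivAt.comp w (f := conj) (g := fun w => f (I.emb w)) h₂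
        Complex.conjCLE.hasFDerivAt
    have h := h₀.sub (((h₁.const_mul (1 - (K : ℍ[ℝ]) * I)).add
      (h₂'.const_mul (1 + (K : ℍ[ℝ]) * I))).const_smul (1 / 2 : ℝ))
    refine (SliceSpace.hasDerivAt_lift (K := K) (F := g) h (a := a₀ - rep I K a₁ a₂)
      fun v => ?_).differentiableAt.differentiableWithinAt
    change L₀ v - (1 / 2 : ℝ) • ((1 - (K : ℍ[ℝ]) * I) * L₁ v +
      (1 + (K : ℍ[ℝ]) * I) * L₂ (conj v)) = _
    rw [hL₀, hL₁, hL₂, ← mul_assoc, ← mul_assoc, one_sub_mul_emb, one_add_mul_emb_conj, mul_assoc,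
      mul_assoc, ← mul_add, mul_sub, rep, mul_smul_comm]
  have hreal : ∃ᶠ w in 𝓝[≠] (p : ℂ), SliceSpace.lift K g w = 0 := by
    have ht : Tendsto (fun x : ℝ => (x : ℂ)) (𝓝[≠] p) (𝓝[≠] (p : ℂ)) :=
      Complex.continuous_ofReal.continuousAt.tendsto.mono_left nhdsWithin_le_nhds
        |> fun h => tendsto_nhdsWithin_iff.2 ⟨h, by
          filter_upwards [self_mem_nhdsWithin] with x hx
          simpa using hx⟩
    refine ht.frequently (Eventually.frequently (Eventually.of_forall fun x => ?_))
    change g x = 0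
    simp only [hg, Complex.conj_ofReal, emb_ofReal, rep_self, sub_self]
  have h0 := (hdiff.analyticOnNhd hTo).eqOn_zero_of_preconnected_of_frequently_eq_zero
    (hTstar.isPathConnected hpT).isConnected.isPreconnected hpT hreal
  exact sub_eq_zero.1 (h0 ⟨hK, hI, hIc⟩)

/-- Slice regular functions on a starlike body are uniform limits of polynomials. -/
theorem IsStarJordanBody.exists_polynomial {S : Set ℍ[ℝ]} {p : ℝ} (hS : IsStarJordanBody S p)
    {f : ℍ[ℝ] → ℍ[ℝ]} (hf : SliceRegularOn f S) (hfc : ContinuousOn f (closure S)) {ε : ℝ}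
    (hε : 0 < ε) :
    ∃ (n : ℕ) (a : ℕ → ℍ[ℝ]), ∀ q ∈ closure S, ‖f q - ∑ k ∈ Finset.range n, q ^ k * a k‖ ≤ ε := by
  obtain ⟨I, hI⟩ := hS.exists_closure_slice
  have hIc := I.isometry_emb.continuous
  have hIcl : closure (I.emb ⁻¹' S) ⊆ I.emb ⁻¹' closure S := hIc.closure_preimage_subset S
  have happ : PolyApprox (closure (I.emb ⁻¹' S)) (SliceSpace.lift I fun z => f (I.emb z)) := by
    refine (hS.isStarJordan_slice I).polyApprox (fun z hz => ?_) ?_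
    · obtain ⟨L, a, hL, hLa⟩ := hf.exists_hasFDerivAt_emb hS.isOpen I hz
      exact (SliceSpace.hasDerivAt_lift hL hLa).differentiableAt.differentiableWithinAt
    · exact hfc.comp hIc.continuousOn hIcl
  obtain ⟨c, hc⟩ := happ (ε / 2) (by positivity)
  obtain ⟨n, hn⟩ := c.support.exists_nat_subset_range
  set a : ℕ → ℍ[ℝ] := fun k => c k with ha
  set P : ℍ[ℝ] → ℍ[ℝ] := fun q => ∑ k ∈ Finset.range n, q ^ k * a k with hP
  have hPc : Continuous P := by rw [hP]; fun_prop
  have hcP : ∀ z, I.emb z ∈ closure S → ‖f (I.emb z) - P (I.emb z)‖ < ε / 2 := by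
    intro z hz
    have h := hc z (hI z hz)
    rw [Finsupp.sum_of_support_subset c hn _ (fun _ _ => smul_zero _)] at h
    have hsum : (∑ k ∈ Finset.range n, z ^ k • c k : SliceSpace I) = P (I.emb z) := by
      refine Finset.sum_congr rfl fun k _ => ?_
      change I.emb (z ^ k) * a k = _
      rw [map_pow]
    rw [hsum] at h
    exact h
  have hPrep : ∀ (K : UnitImag) z, P (K.emb z) = rep I K (P (I.emb z)) (P (I.emb (conj z))) := by
    intro K z
    simp only [hP]
    rw [rep_sum]
    refine Finset.sum_congr rfl fun k _ => ?_
    rw [rep_mul, ← map_pow, ← map_pow, ← map_pow, ← map_pow, rep_emb]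
  refine ⟨n, a, ?_⟩
  change ∀ q ∈ closure S, ‖f q - P q‖ ≤ ε
  set R : Set ℍ[ℝ] := {q ∈ S | ‖f q - P q‖ ≤ ε} with hR
  have hRS : S ⊆ closure R := by
    intro q hq
    obtain ⟨K, z, rfl⟩ := exists_emb q
    have hconj : IsOpen (conj ⁻¹' (I.emb ⁻¹' S) : Set ℂ) :=
      (hS.isOpen_slice I).preimage Complex.continuous_conj
    have hsub : K.emb ⁻¹' S ∩ (I.emb ⁻¹' S ∩ conj ⁻¹' (I.emb ⁻¹' S)) ⊆ K.emb ⁻¹' R := by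
      rintro w ⟨h0, h1, h2⟩
      refine ⟨h0, ?_⟩
      rw [hS.rep_eq hf I K h0 h1 h2, hPrep, ← rep_sub]
      refine (norm_rep_le I K _ _).trans ?_
      linarith [hcP w (subset_closure h1), hcP (conj w) (subset_closure h2)]
    have hz : z ∈ closure (K.emb ⁻¹' S ∩ (I.emb ⁻¹' S ∩ conj ⁻¹' (I.emb ⁻¹' S))) := by
      have hD : ∀ w, K.emb w ∈ S → I.emb w ∈ closure S := fun w hw =>
        (hS.emb_mem_closure_iff K I).1 (subset_closure hw)
      have hcl : ∀ w, I.emb w ∈ closure S → w ∈ closure (conj ⁻¹' (I.emb ⁻¹' S)) := by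
        intro w hw
        have := hI _ (hS.emb_conj_mem_closure I hw)
        have e := Complex.conjCLE.toHomeomorph.preimage_closure (I.emb ⁻¹' S)
        exact e.subset this
      rw [← inter_assoc]
      have h1 : z ∈ closure (K.emb ⁻¹' S ∩ I.emb ⁻¹' S) :=
        (hS.isOpen_slice K).inter_closure ⟨hq, hI z (hD z hq)⟩
      refine closure_minimal ?_ isClosed_closure h1
      intro w hw
      exact ((hS.isOpen_slice K).inter (hS.isOpen_slice I)).inter_closure
        ⟨hw, hcl w (hD w hw.1)⟩
    exact K.isometry_emb.continuous.closure_preimage_subset R (closure_mono hsub hz)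
  intro q hq
  have hqR : q ∈ closure R := closure_minimal hRS isClosed_closure hq
  have hcont : ContinuousWithinAt (fun q => ‖f q - P q‖) R q :=
    ((hfc.sub hPc.continuousOn).norm q hq).mono fun y hy => subset_closure hy.1
  exact hcont.closure_le hqR continuousWithinAt_const fun y hy => hy.2

end SliceAnalysis

/-- **Approximation with interpolation on starlike sets.** Let `S ⊂ ℍ` be a bounded
Jordan region (bounded open connected set all of whose slices `S ∩ ℂ_I` are Jordan
regions in `ℂ_I`), starlike with respect to a real point `p`, with `closure S` axially
symmetric, connected complement of `closure S` in the one-point compactification of `ℍ`,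
and connected complement of `closure S ∩ ℂ_I` in the one-point compactification of each
plane `ℂ_I`. Let `α ∈ closure S`. If `f` is slice regular on `S` and continuous on
`closure S`, then for every `ε > 0` there is a polynomial `P(q) = ∑_{k=0}^n q^k a_k`
with `P(α) = f(α)` and `sup_{q ∈ closure S} ‖f q − P q‖ < ε`. -/
theorem approximation_with_interpolation_on_starlike
    (S : Set (Quaternion ℝ)) (hSopen : IsOpen S) (hSconn : IsConnected S)
    (hSbdd : Bornology.IsBounded S)
    (hSjordan : ∀ I : Quaternion ℝ, I ^ 2 = -1 → IsJordanRegionIn I (S ∩ slicePlane I))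
    (p : ℝ)
    (hSstar : ∀ q ∈ S, ∀ t : ℝ, t ∈ Set.Icc (0 : ℝ) 1 →
      (p : Quaternion ℝ) + t • (q - (p : Quaternion ℝ)) ∈ S)
    (hax : AxiallySymmetric (closure S))
    (hconn : IsConnected ((OnePoint.some '' closure S)ᶜ : Set (OnePoint (Quaternion ℝ))))
    (hconnI : ∀ I : Quaternion ℝ, I ^ 2 = -1 →
      IsConnected ((OnePoint.some ''
          (Subtype.val ⁻¹' closure S : Set ↥(slicePlane I)))ᶜ :
        Set (OnePoint ↥(slicePlane I))))
    (α : Quaternion ℝ) (hα : α ∈ closure S)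
    (f : Quaternion ℝ → Quaternion ℝ)
    (hfreg : SliceRegularOn f S) (hfcont : ContinuousOn f (closure S))
    (ε : ℝ) (hε : 0 < ε) :
    ∃ (n : ℕ) (a : ℕ → Quaternion ℝ),
      (∑ k ∈ Finset.range (n + 1), α ^ k * a k) = f α ∧
      ∀ q ∈ closure S, ‖f q - ∑ k ∈ Finset.range (n + 1), q ^ k * a k‖ < ε := by
  have hp : (p : Quaternion ℝ) ∈ S := by
    obtain ⟨q, hq⟩ := hSconn.nonempty
    simpa using hSstar q hq 0 (by simp)
  have hS : IsStarJordanBody S p := ⟨hSopen, hSbdd, hSjordan, hp, hSstar, hax⟩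
  obtain ⟨n, a, ha⟩ := hS.exists_polynomial hfreg hfcont (ε := ε / 4) (by positivity)
  set d : Quaternion ℝ := f α - ∑ k ∈ Finset.range n, α ^ k * a k with hd
  have hsum : ∀ q : Quaternion ℝ, ∑ k ∈ Finset.range (n + 1),
      q ^ k * ((if k < n then a k else 0) + if k = 0 then d else 0) =
      ∑ k ∈ Finset.range n, q ^ k * a k + d := by
    intro q
    simp only [mul_add, Finset.sum_add_distrib]
    congr 1
    · rw [Finset.sum_range_succ, if_neg (lt_irrefl n), mul_zero, add_zero]
      exact Finset.sum_congr rfl fun k hk => by rw [if_pos (Finset.mem_range.1 hk)]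
    · rw [Finset.sum_eq_single 0] <;> simp +contextual
  refine ⟨n, _, by rw [hsum, hd, add_sub_cancel], fun q hq => ?_⟩
  rw [hsum, ← sub_sub]
  have h := norm_sub_le (f q - ∑ k ∈ Finset.range n, q ^ k * a k) d
  linarith [ha q hq, ha α hα]
end
end
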